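/- Strict Positivstellensatz for compact semi-algebraic sets (Schmüdgen): Let f₁,…,f_k ∈ ℝ[x₁,…,x_d] be such that the basic closed semi-algebraic set K(f) is compact. If h ∈ ℝ[x₁,…,x_d] satisfies h(x) > 0 for all x ∈ K(f), then h belongs to the preordering T(f) generated by f₁,…,f_k. -/

import Mathlib

/-- A sum of squares of polynomials. -/
def IsSOS {d : ℕ} (p : MvPolynomial (Fin d) ℝ) : Prop :=
  ∃ (n : ℕ) (q : Fin n → MvPolynomial (Fin d) ℝ), p = ∑ i, (q i) ^ 2

/-- Membership in the preordering `T(f)` generated by `f 0, …, f (k-1)`. -/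
def InPreordering {d k : ℕ} (f : Fin k → MvPolynomial (Fin d) ℝ)
    (p : MvPolynomial (Fin d) ℝ) : Prop :=
  ∃ σ : (Fin k → Bool) → MvPolynomial (Fin d) ℝ,
    (∀ e, IsSOS (σ e)) ∧
    p = ∑ e : Fin k → Bool, (∏ i, if e i then f i else 1) * σ e

/-- The basic closed semi-algebraic set `K(f)`. -/
def SemiAlgSet {d k : ℕ} (f : Fin k → MvPolynomial (Fin d) ℝ) : Set (Fin d → ℝ) :=
  {x | ∀ i, 0 ≤ MvPolynomial.eval x (f i)}

section helpers
open Polynomial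


def PIVT (M : Type) [Field M] [LinearOrder M] : Prop :=
  ∀ (p : M[X]) (a b : M), a < b → p.eval a < 0 → 0 < p.eval b → ∃ c, a < c ∧ c < b ∧ p.eval c = 0

section
variable {M : Type} [Field M] [LinearOrder M] [IsStrictOrderedRing M]

lemma PIVT.exists_root (hM : PIVT M) (p : M[X]) {a b : M} (hab : a < b)
    (h : p.eval a * p.eval b < 0) : ∃ c, a < c ∧ c < b ∧ p.eval c = 0 := by
  rcases mul_neg_iff.1 h with ⟨h1, h2⟩ | ⟨h1, h2⟩
  · obtain ⟨c, h3, h4, h5⟩ := hM (-p) a b hab (by simpa using h1) (by simpa using h2)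
    exact ⟨c, h3, h4, by simpa using h5⟩
  · exact hM p a b hab h1 h2

lemma PIVT.mul_pos (hM : PIVT M) (p : M[X]) {a b : M} (hab : a ≤ b)
    (h : ∀ t, a ≤ t → t ≤ b → p.eval t ≠ 0) : 0 < p.eval a * p.eval b := by
  rcases hab.eq_or_lt with rfl | hab
  · exact mul_self_pos.2 (h a le_rfl le_rfl)
  by_contra hc
  have h1 := h a le_rfl hab.le
  have h2 := h b hab.le le_rfl
  have : p.eval a * p.eval b < 0 := lt_of_le_of_ne (not_lt.1 hc) (mul_ne_zero h1 h2)
  obtain ⟨c, h3, h4, h5⟩ := hM.exists_root p hab this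
  exact h c h3.le h4.le h5

lemma sign_eq_of_mul_pos {a b : M} (h : 0 < a * b) : SignType.sign a = SignType.sign b := by
  rcases mul_pos_iff.1 h with ⟨h1, h2⟩ | ⟨h1, h2⟩
  · rw [sign_pos h1, sign_pos h2]
  · rw [sign_neg h1, sign_neg h2]

lemma PIVT.sign_eq (hM : PIVT M) (p : M[X]) {a b : M}
    (h : ∀ t, min a b ≤ t → t ≤ max a b → p.eval t ≠ 0) :
    SignType.sign (p.eval a) = SignType.sign (p.eval b) := by
  rcases le_total a b with hab | hab
  · exact sign_eq_of_mul_pos (hM.mul_pos p hab (by simpa [hab] using h))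
  · exact (sign_eq_of_mul_pos (hM.mul_pos p hab (by simpa [hab] using h))).symm

lemma PIVT.rolle_aux (hM : PIVT M) (p : M[X]) (hp : p ≠ 0) {a b : M} (hab : a < b)
    (ha : p.eval a = 0) (hb : p.eval b = 0) (hno : ∀ t, a < t → t < b → p.eval t ≠ 0) :
    ∃ c, a < c ∧ c < b ∧ p.derivative.eval c = 0 := by
  obtain ⟨q, hq, hqa⟩ := exists_eq_pow_rootMultiplicity_mul_and_not_dvd p hp a
  set m := rootMultiplicity a p with hm
  have hm0 : 0 < m := (rootMultiplicity_pos hp).2 ha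
  have hq0 : q ≠ 0 := by rintro rfl; simp at hqa
  obtain ⟨r, hr, hrb⟩ := exists_eq_pow_rootMultiplicity_mul_and_not_dvd q hq0 b
  set l := rootMultiplicity b q with hl
  have hqb : q.eval b = 0 := by
    rw [hq] at hb
    simp only [eval_mul, eval_pow, eval_sub, eval_X, eval_C, mul_eq_zero] at hb
    rcases hb with hb | hb
    · exact absurd (pow_eq_zero_iff hm0.ne' |>.1 hb) (sub_ne_zero.2 hab.ne')
    · exact hb
  have hl0 : 0 < l := (rootMultiplicity_pos hq0).2 hqb
  have hra : r.eval a ≠ 0 := by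
    intro h
    apply hqa
    rw [dvd_iff_isRoot, hr]; simp [h]
  have hrb : r.eval b ≠ 0 := by
    intro h
    exact hrb (dvd_iff_isRoot.2 h)
  have hpr : p = (X - C a) ^ m * ((X - C b) ^ l * r) := by rw [← hr, ← hq]
  have hpos : 0 < r.eval a * r.eval b := by
    apply hM.mul_pos r hab.le
    intro t h1 h2 h3
    rcases h1.eq_or_lt with rfl | h1
    · exact hra h3
    rcases h2.eq_or_lt with rfl | h2
    · exact hrb h3
    apply hno t h1 h2
    rw [hpr]; simp [h3]
  obtain ⟨m', hm'⟩ : ∃ m', m = m' + 1 := ⟨m - 1, by omega⟩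
  obtain ⟨l', hl'⟩ : ∃ l', l = l' + 1 := ⟨l - 1, by omega⟩
  let q1 : M[X] := C (m : M) * (X - C b) * r + C (l : M) * (X - C a) * r
    + (X - C a) * (X - C b) * derivative r
  have hder : derivative p = (X - C a) ^ m' * (X - C b) ^ l' * q1 := by
    rw [hpr]
    simp only [q1, derivative_mul, derivative_X_sub_C_pow, hm', hl', Nat.add_sub_cancel]
    push_cast
    simp only [C_add, C_1, map_natCast]
    ring
  have h1 : q1.eval a * q1.eval b < 0 := by
    simp only [q1, eval_add, eval_mul, eval_C, eval_sub, eval_X, sub_self]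
    have : (0 : M) < m := by exact_mod_cast hm0
    have : (0 : M) < l := by exact_mod_cast hl0
    have h3 : 0 < b - a := sub_pos.2 hab
    have : 0 < (m : M) * l * (b - a) ^ 2 * (r.eval a * r.eval b) := by positivity
    nlinarith
  obtain ⟨c, h3, h4, h5⟩ := hM.exists_root q1 hab h1
  exact ⟨c, h3, h4, by rw [hder]; simp [h5]⟩

lemma PIVT.rolle (hM : PIVT M) (p : M[X]) (hp : p ≠ 0) {a b : M} (hab : a < b)
    (ha : p.eval a = 0) (hb : p.eval b = 0) :
    ∃ c, a < c ∧ c < b ∧ p.derivative.eval c = 0 := by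
  classical
  let s := p.roots.toFinset.filter (fun t => a < t)
  have hs : ∀ t, t ∈ s ↔ a < t ∧ p.eval t = 0 := by
    intro t; simp [s, hp, and_comm]
  have hne : s.Nonempty := ⟨b, (hs b).2 ⟨hab, hb⟩⟩
  have h1 := (hs _).1 (s.min'_mem hne)
  have h2 : s.min' hne ≤ b := s.min'_le _ ((hs b).2 ⟨hab, hb⟩)
  obtain ⟨c, h3, h4, h5⟩ := hM.rolle_aux p hp h1.1 ha h1.2 (by
    intro t ht1 ht2 h0
    exact absurd (s.min'_le t ((hs t).2 ⟨ht1, h0⟩)) (not_le.2 ht2))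
  exact ⟨c, h3, h4.trans_le h2, h5⟩

/-- sign pattern near the only root -/
lemma PIVT.simple_root (hM : PIVT M) (p : M[X]) (hp : p ≠ 0) {c α d : M} (h1 : c < α) (h2 : α < d)
    (hα : p.eval α = 0) (hd : ∀ t, c < t → t < d → p.derivative.eval t ≠ 0) :
    ∀ t, c ≤ t → t ≤ d → SignType.sign (p.eval t) =
      SignType.sign (p.derivative.eval α) * SignType.sign (t - α) := by
  obtain ⟨q, hq⟩ := dvd_iff_isRoot.2 hα
  have hqα : q.eval α = p.derivative.eval α := by rw [hq]; simp
  have hno : ∀ t, c ≤ t → t ≤ d → q.eval t ≠ 0 := by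
    intro t h3 h4 h5
    have h6 : p.eval t = 0 := by rw [hq]; simp [h5]
    rcases lt_trichotomy t α with h | rfl | h
    · obtain ⟨e, h7, h8, h9⟩ := hM.rolle p hp h h6 hα
      exact hd e (h3.trans_lt h7) (h8.trans h2) h9
    · exact hd t h1 h2 (hqα ▸ h5)
    · obtain ⟨e, h7, h8, h9⟩ := hM.rolle p hp h hα h6
      exact hd e (h1.trans h7) (h8.trans_le h4) h9
  intro t h3 h4
  have h5 : SignType.sign (q.eval α) = SignType.sign (q.eval t) := by
    apply hM.sign_eq
    intro u h6 h7
    exact hno u ((le_min h1.le h3).trans h6) (h7.trans (max_le h2.le h4))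
  rw [← hqα, h5, hq]
  simp [sign_mul, mul_comm]

/-- root bound -/
lemma root_bound (p : M[X]) (hp : p.Monic) (α : M) (hα : p.eval α = 0) :
    |α| ≤ 1 + ∑ i ∈ Finset.range p.natDegree, |p.coeff i| := by
  by_contra hc
  push Not at hc
  have hS : 0 ≤ ∑ i ∈ Finset.range p.natDegree, |p.coeff i| :=
    Finset.sum_nonneg fun _ _ => abs_nonneg _
  have h1 : 1 < |α| := by linarith
  have h0 : 0 < |α| := by linarith
  have hn : p.natDegree ≠ 0 := by
    intro h
    rw [hp.natDegree_eq_zero.1 h] at hα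
    simp at hα
  obtain ⟨n, hn⟩ := Nat.exists_eq_succ_of_ne_zero hn
  have h2 : α ^ p.natDegree = - ∑ i ∈ Finset.range p.natDegree, p.coeff i * α ^ i := by
    rw [eval_eq_sum_range, Finset.sum_range_succ, hp.coeff_natDegree] at hα
    linarith
  have h3 : |α| ^ p.natDegree ≤ (∑ i ∈ Finset.range p.natDegree, |p.coeff i|) * |α| ^ n := by
    rw [← abs_pow, h2, abs_neg, Finset.sum_mul]
    refine (Finset.abs_sum_le_sum_abs _ _).trans (Finset.sum_le_sum fun i hi => ?_)
    rw [abs_mul, abs_pow]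
    refine mul_le_mul_of_nonneg_left (pow_le_pow_right₀ h1.le ?_) (abs_nonneg _)
    have := Finset.mem_range.1 hi
    omega
  have h4 : 0 < |α| ^ n := by positivity
  rw [hn, pow_succ, mul_comm] at h3
  have := le_of_mul_le_mul_right h3 h4
  rw [hn] at hc
  linarith
end


section
variable {K M G : Type} [Field K] [Field M] [LinearOrder M] [IsStrictOrderedRing M]
  [Field G] [LinearOrder G] [IsStrictOrderedRing G]

def ClosedBelow {K M : Type} [CommRing K] [Field M] (φ : K →+* M) (n : ℕ) : Prop :=
  ∀ q : K[X], q ≠ 0 → q.natDegree < n → ∀ α, q.eval₂ φ α = 0 → ∃ k, φ k = α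

lemma sign_poly (hM : PIVT M) (hG : PIVT G) (φ : K →+* M) (ψ : K →+* G)
    (hc : ∀ k, SignType.sign (φ k) = SignType.sign (ψ k)) (n : ℕ)
    (h1 : ClosedBelow φ n) (h2 : ClosedBelow ψ n) {α : M} {β : G}
    (hcut : ∀ k, SignType.sign (α - φ k) = SignType.sign (β - ψ k)) :
    ∀ m (q : K[X]), q.natDegree = m → m < n →
      SignType.sign (q.eval₂ φ α) = SignType.sign (q.eval₂ ψ β) := by
  intro m
  induction m using Nat.strong_induction_on with
  | _ m ih =>
  intro q hq hmn
  by_cases hq0 : q = 0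
  · simp [hq0]
  by_cases hr : ∃ r, q.eval r = 0
  · obtain ⟨r, hr⟩ := hr
    obtain ⟨q1, rfl⟩ := dvd_iff_isRoot.2 hr
    have hq1 : q1 ≠ 0 := by rintro rfl; simp at hq0
    have hdeg : q1.natDegree < m := by
      rw [natDegree_mul (X_sub_C_ne_zero r) hq1, natDegree_X_sub_C] at hq
      omega
    have := ih _ hdeg q1 rfl (by omega)
    simp [eval₂_mul, sign_mul, this, hcut]
  · push Not at hr
    have e1 : ∀ t, (q.map φ).eval t ≠ 0 := by
      intro t ht
      rw [eval_map] at ht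
      obtain ⟨k, rfl⟩ := h1 q hq0 (by omega) t ht
      rw [eval₂_at_apply, map_eq_zero] at ht
      exact hr k ht
    have e2 : ∀ t, (q.map ψ).eval t ≠ 0 := by
      intro t ht
      rw [eval_map] at ht
      obtain ⟨k, rfl⟩ := h2 q hq0 (by omega) t ht
      rw [eval₂_at_apply, map_eq_zero] at ht
      exact hr k ht
    rw [← eval_map, ← eval_map, hM.sign_eq (q.map φ) (a := α) (b := φ 0) (fun t _ _ => e1 t),
      hG.sign_eq (q.map ψ) (a := β) (b := ψ 0) (fun t _ _ => e2 t), eval_map, eval_map,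
      eval₂_at_apply, eval₂_at_apply, hc]

lemma lt_iff_of_compat {φ : K →+* M} {ψ : K →+* G}
    (hc : ∀ k, SignType.sign (φ k) = SignType.sign (ψ k)) (a b : K) : φ a < φ b ↔ ψ a < ψ b := by
  have := hc (b - a)
  rw [← sub_pos, ← sub_pos (a := ψ b), ← map_sub, ← map_sub, ← sign_eq_one_iff,
    ← sign_eq_one_iff, this]

lemma exists_bound (φ : K →+* M) (p : K[X]) (hp : p.Monic) (α : M) (hα : p.eval₂ φ α = 0) :
    ∃ B : K, |α| ≤ φ B := by
  have h1 := root_bound (p.map φ) (hp.map φ) α (by rwa [eval_map])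
  have h2 : ∀ k : K, ∃ k', |φ k| = φ k' := by
    intro k
    rcases abs_choice (φ k) with h | h
    · exact ⟨k, h⟩
    · exact ⟨-k, by rw [h, map_neg]⟩
  choose ab hab using h2
  refine ⟨1 + ∑ i ∈ Finset.range (p.map φ).natDegree, ab (p.coeff i), ?_⟩
  rw [map_add, map_one, map_sum]
  simpa [hab] using h1

lemma key_ext (hM : PIVT M) (hG : PIVT G) (φ : K →+* M) (ψ : K →+* G)
    (hc : ∀ k, SignType.sign (φ k) = SignType.sign (ψ k)) (n : ℕ)
    (h1 : ClosedBelow φ n) (h2 : ClosedBelow ψ n) (p : K[X]) (hp : p.Monic)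
    (hpn : p.natDegree = n) (α : M) (hα : p.eval₂ φ α = 0) (hαK : ∀ k, φ k ≠ α) :
    ∃ β, p.eval₂ ψ β = 0 ∧ ∀ k, SignType.sign (α - φ k) = SignType.sign (β - ψ k) := by
  classical
  have hn0 : p.natDegree ≠ 0 := by
    intro h
    rw [hp.natDegree_eq_zero.1 h] at hα
    simp at hα
  have : CharZero K := by
    refine ⟨fun a b hab => ?_⟩
    have : φ a = φ b := by rw [hab]
    simpa using this
  have hp'0 : p.derivative ≠ 0 := by
    intro h
    exact hn0 (derivative_eq_zero.1 h)
  have hp'n : p.derivative.natDegree < n := by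
    rw [← hpn]; exact natDegree_derivative_lt hn0
  obtain ⟨B, hB⟩ := exists_bound φ p hp α hα
  have hB1 := neg_le_of_abs_le hB
  have hB2 := le_of_abs_le hB
  let s := p.derivative.roots.toFinset
  have hs : ∀ k, k ∈ s ↔ p.derivative.eval k = 0 := by intro k; simp [s, hp'0]
  obtain ⟨c, hcm, hcmax⟩ := (insert (-(B + 1)) (s.filter (fun k => φ k < α))).exists_max_image φ
    (Finset.insert_nonempty _ _)
  obtain ⟨d, hdm, hdmin⟩ := (insert (B + 1) (s.filter (fun k => α < φ k))).exists_min_image φ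
    (Finset.insert_nonempty _ _)
  have hcα : φ c < α := by
    rcases Finset.mem_insert.1 hcm with rfl | h
    · simp only [map_neg, map_add, map_one]; linarith
    · exact (Finset.mem_filter.1 h).2
  have hαd : α < φ d := by
    rcases Finset.mem_insert.1 hdm with rfl | h
    · simp only [map_add, map_one]; linarith
    · exact (Finset.mem_filter.1 h).2
  have hdK : ∀ k, φ c < φ k → φ k < φ d → p.derivative.eval k ≠ 0 := by
    intro k hk1 hk2 hk3
    rcases lt_trichotomy (φ k) α with h | h | h
    · exact absurd (hcmax k (Finset.mem_insert_of_mem (Finset.mem_filter.2 ⟨(hs k).2 hk3, h⟩)))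
        (not_le.2 hk1)
    · exact hαK k h
    · exact absurd (hdmin k (Finset.mem_insert_of_mem (Finset.mem_filter.2 ⟨(hs k).2 hk3, h⟩)))
        (not_le.2 hk2)
  have hdM : ∀ t, φ c < t → t < φ d → (p.map φ).derivative.eval t ≠ 0 := by
    intro t ht1 ht2 ht
    rw [derivative_map, eval_map] at ht
    obtain ⟨k, rfl⟩ := h1 _ hp'0 hp'n t ht
    rw [eval₂_at_apply, map_eq_zero] at ht
    exact hdK k ht1 ht2 ht
  have hlt := lt_iff_of_compat hc
  have hdG : ∀ t, ψ c < t → t < ψ d → (p.map ψ).derivative.eval t ≠ 0 := by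
    intro t ht1 ht2 ht
    rw [derivative_map, eval_map] at ht
    obtain ⟨k, rfl⟩ := h2 _ hp'0 hp'n t ht
    rw [eval₂_at_apply, map_eq_zero] at ht
    exact hdK k ((hlt _ _).2 ht1) ((hlt _ _).2 ht2) ht
  have sM := hM.simple_root (p.map φ) (hp.map φ).ne_zero hcα hαd (by rwa [eval_map]) hdM
  have hε : (p.map φ).derivative.eval α ≠ 0 := hdM α hcα hαd
  set ε := SignType.sign ((p.map φ).derivative.eval α) with hεdef
  have hε0 : ε ≠ 0 := by rw [hεdef]; simpa using hε
  have tr : ∀ k, SignType.sign ((p.map φ).eval (φ k)) = SignType.sign ((p.map ψ).eval (ψ k)) := by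
    intro k
    rw [eval_map, eval_map, eval₂_at_apply, eval₂_at_apply, hc]
  have hcd : ψ c < ψ d := (hlt _ _).1 (hcα.trans hαd)
  have sc : SignType.sign ((p.map ψ).eval (ψ c)) = ε * -1 := by
    rw [← tr, sM _ le_rfl (hcα.trans hαd).le, sign_neg (sub_neg.2 hcα)]
  have sd : SignType.sign ((p.map ψ).eval (ψ d)) = ε * 1 := by
    rw [← tr, sM _ (hcα.trans hαd).le le_rfl, sign_pos (sub_pos.2 hαd)]
  have hprod : (p.map ψ).eval (ψ c) * (p.map ψ).eval (ψ d) < 0 := by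
    rw [← sign_eq_neg_one_iff, sign_mul, sc, sd]
    revert hε0
    generalize ε = e
    revert e; decide
  obtain ⟨β, hb1, hb2, hb3⟩ := hG.exists_root _ hcd hprod
  have sG := hG.simple_root (p.map ψ) (hp.map ψ).ne_zero hb1 hb2 hb3 hdG
  have hε' : ε = SignType.sign ((p.map ψ).derivative.eval β) := by
    have h3 := sG _ le_rfl hcd.le
    rw [sc, sign_neg (sub_neg.2 hb1)] at h3
    revert h3
    generalize SignType.sign ((p.map ψ).derivative.eval β) = e'
    generalize ε = e
    revert e e'; decide
  refine ⟨β, by rwa [eval_map] at hb3, fun k => ?_⟩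
  rcases lt_or_ge (φ k) (φ c) with h | h
  · have := (hlt _ _).1 h
    rw [sign_pos (sub_pos.2 (h.trans hcα)), sign_pos (sub_pos.2 (this.trans hb1))]
  rcases lt_or_ge (φ d) (φ k) with h' | h'
  · have := (hlt _ _).1 h'
    rw [sign_neg (sub_neg.2 (hαd.trans h')), sign_neg (sub_neg.2 (hb2.trans this))]
  have h3 := sM _ h h'
  have h4 := sG (ψ k) (not_lt.1 fun hh => (not_lt.2 h) ((hlt _ _).2 hh))
    (not_lt.1 fun hh => (not_lt.2 h') ((hlt _ _).2 hh))
  rw [tr, h4, ← hε'] at h3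
  have h5 : SignType.sign (ψ k - β) = SignType.sign (φ k - α) := by
    revert h3 hε0
    generalize SignType.sign (ψ k - β) = x
    generalize SignType.sign (φ k - α) = y
    generalize ε = e
    revert e x y; decide
  rw [← neg_sub, ← neg_sub (ψ k), Left.sign_neg, Left.sign_neg, h5]

/-- extension in the algebraic case: signs agree on all polynomials. -/
lemma key_sign (hM : PIVT M) (hG : PIVT G) (φ : K →+* M) (ψ : K →+* G)
    (hc : ∀ k, SignType.sign (φ k) = SignType.sign (ψ k)) (n : ℕ)
    (h1 : ClosedBelow φ n) (h2 : ClosedBelow ψ n) (p : K[X]) (hp : p.Monic)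
    (hpn : p.natDegree = n) (α : M) (hα : p.eval₂ φ α = 0) (hαK : ∀ k, φ k ≠ α) :
    ∃ β, ∀ q : K[X], SignType.sign (q.eval₂ φ α) = SignType.sign (q.eval₂ ψ β) := by
  obtain ⟨β, hβ, hcut⟩ := key_ext hM hG φ ψ hc n h1 h2 p hp hpn α hα hαK
  refine ⟨β, fun q => ?_⟩
  have hp1 : p ≠ 1 := by rintro rfl; simp at hα
  have hlt : (q %ₘ p).natDegree < n := by
    rw [← hpn]; exact natDegree_modByMonic_lt q hp hp1
  have := sign_poly hM hG φ ψ hc n h1 h2 hcut _ _ rfl hlt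
  rw [← modByMonic_add_div q p]
  simpa [eval₂_add, eval₂_mul, hα, hβ] using this
end


section
variable {M G : Type} [Field M] [LinearOrder M] [IsStrictOrderedRing M]
  [Field G] [LinearOrder G] [IsStrictOrderedRing G]

def Compat (S : Subring (M × G)) : Prop :=
  ∀ s ∈ S, SignType.sign s.1 = SignType.sign s.2

lemma Compat.zero_iff {S : Subring (M × G)} (hS : Compat S) {s : M × G} (hs : s ∈ S) :
    s.1 = 0 ↔ s.2 = 0 := by
  rw [← sign_eq_zero_iff, hS s hs, sign_eq_zero_iff]

def fracSub (S : Subring (M × G)) (hS : Compat S) : Subring (M × G) where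
  carrier := {z | ∃ a ∈ S, ∃ b ∈ S, b.1 ≠ 0 ∧ b.2 ≠ 0 ∧ z.1 * b.1 = a.1 ∧ z.2 * b.2 = a.2}
  mul_mem' := by
    rintro x y ⟨a, ha, b, hb, h1, h2, h3, h4⟩ ⟨a', ha', b', hb', h1', h2', h3', h4'⟩
    refine ⟨a * a', S.mul_mem ha ha', b * b', S.mul_mem hb hb', mul_ne_zero h1 h1',
      mul_ne_zero h2 h2', ?_, ?_⟩
    · simp only [Prod.fst_mul, ← h3, ← h3']; ring
    · simp only [Prod.snd_mul, ← h4, ← h4']; ring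
  one_mem' := ⟨1, S.one_mem, 1, S.one_mem, by simp, by simp, by simp, by simp⟩
  add_mem' := by
    rintro x y ⟨a, ha, b, hb, h1, h2, h3, h4⟩ ⟨a', ha', b', hb', h1', h2', h3', h4'⟩
    refine ⟨a * b' + a' * b, S.add_mem (S.mul_mem ha hb') (S.mul_mem ha' hb), b * b',
      S.mul_mem hb hb', mul_ne_zero h1 h1', mul_ne_zero h2 h2', ?_, ?_⟩
    · simp only [Prod.fst_mul, Prod.fst_add, ← h3, ← h3']; ring
    · simp only [Prod.snd_mul, Prod.snd_add, ← h4, ← h4']; ring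
  zero_mem' := ⟨0, S.zero_mem, 1, S.one_mem, by simp, by simp, by simp, by simp⟩
  neg_mem' := by
    rintro x ⟨a, ha, b, hb, h1, h2, h3, h4⟩
    exact ⟨-a, S.neg_mem ha, b, hb, h1, h2, by simp [h3], by simp [h4]⟩

lemma le_fracSub (S : Subring (M × G)) (hS : Compat S) : S ≤ fracSub S hS :=
  fun x hx => ⟨x, hx, 1, S.one_mem, by simp, by simp, by simp, by simp⟩

lemma compat_fracSub (S : Subring (M × G)) (hS : Compat S) : Compat (fracSub S hS) := by
  rintro x ⟨a, ha, b, hb, h1, h2, h3, h4⟩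
  have e1 := hS a ha
  have e2 := hS b hb
  rw [← h3, ← h4, sign_mul, sign_mul, e2] at e1
  have e3 : SignType.sign b.2 ≠ 0 := by simpa using h2
  revert e1 e3
  generalize SignType.sign b.2 = u
  generalize SignType.sign x.1 = v
  generalize SignType.sign x.2 = w
  revert u v w; decide

lemma compat_zorn (S0 : Subring (M × G)) (h0 : Compat S0) :
    ∃ S, S0 ≤ S ∧ Maximal Compat S := by
  refine zorn_le_nonempty₀ {S | Compat S} ?_ S0 h0
  intro c hc hch y hy
  refine ⟨sSup c, ?_, fun z hz => le_sSup hz⟩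
  intro s hs
  rw [Subring.mem_sSup_of_directedOn ⟨y, hy⟩ hch.directedOn] at hs
  obtain ⟨T, hT, hsT⟩ := hs
  exact hc hT s hsT

lemma back_forth (hM : PIVT M) (hG : PIVT G) {K0 : Type} [CommRing K0] (φ0 : K0 →+* M)
    (ψ0 : K0 →+* G) (hc0 : ∀ k, SignType.sign (φ0 k) = SignType.sign (ψ0 k)) :
    ∃ (K : Type) (_ : Field K) (φ : K →+* M) (ψ : K →+* G),
      (∀ k, SignType.sign (φ k) = SignType.sign (ψ k)) ∧
      (∀ n, ClosedBelow φ n ∧ ClosedBelow ψ n) ∧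
      ∀ k0, ∃ k, φ k = φ0 k0 ∧ ψ k = ψ0 k0 := by
  obtain ⟨S, hS0, hS⟩ := compat_zorn (φ0.prod ψ0).range (by
    rintro _ ⟨k, rfl⟩; exact hc0 k)
  have hcS : Compat S := hS.prop
  have hfr : fracSub S hcS ≤ S := hS.le_of_ge (compat_fracSub S hcS) (le_fracSub S hcS)
  have hF : IsField S := by
    refine ⟨⟨0, 1, zero_ne_one⟩, mul_comm, ?_⟩
    rintro ⟨⟨a, b⟩, hab⟩ hne
    have hz := hcS.zero_iff hab
    simp only at hz
    have ha : a ≠ 0 := by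
      intro ha
      have hb := hz.1 ha
      apply hne
      ext <;> simp [ha, hb]
    have hb : b ≠ 0 := fun h => ha (hz.2 h)
    refine ⟨⟨(a⁻¹, b⁻¹), hfr ⟨1, S.one_mem, (a, b), hab, ha, hb, ?_, ?_⟩⟩, ?_⟩
    · simp [ha]
    · simp [hb]
    · ext <;> simp [ha, hb]
  let φ : S →+* M := (RingHom.fst M G).comp S.subtype
  let ψ : S →+* G := (RingHom.snd M G).comp S.subtype
  have hc : ∀ k, SignType.sign (φ k) = SignType.sign (ψ k) := fun k => hcS k.1 k.2
  have hext : ∀ (α : M) (β : G),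
      (∀ q : S[X], SignType.sign (q.eval₂ φ α) = SignType.sign (q.eval₂ ψ β)) → (α, β) ∈ S := by
    intro α β h
    let F : S[X] →+* M × G := (eval₂RingHom φ α).prod (eval₂RingHom ψ β)
    have h1 : F.range ≤ S := by
      apply hS.le_of_ge
      · rintro _ ⟨q, rfl⟩; exact h q
      · intro s hs
        refine ⟨C ⟨s, hs⟩, ?_⟩
        simp [F, φ, ψ]
    exact h1 ⟨X, by simp [F]⟩
  letI := hF.toField
  refine ⟨S, hF.toField, φ, ψ, hc, ?_, ?_⟩
  · intro n
    induction n with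
    | zero => exact ⟨fun _ _ h => absurd h (Nat.not_lt_zero _), fun _ _ h => absurd h (Nat.not_lt_zero _)⟩
    | succ n ih =>
      constructor
      · intro q hq hn α hα
        by_contra hno
        push Not at hno
        rcases Nat.lt_or_ge q.natDegree n with h | h
        · obtain ⟨k, hk⟩ := ih.1 q hq h α hα
          exact hno k hk
        have hm : (q * C q.leadingCoeff⁻¹).Monic := monic_mul_leadingCoeff_inv hq
        obtain ⟨β, hβ⟩ := key_sign hM hG φ ψ hc n ih.1 ih.2 _ hm
          (by rw [natDegree_mul_C (inv_ne_zero (leadingCoeff_ne_zero.2 hq))]; omega) α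
          (by rw [eval₂_mul, hα, zero_mul]) hno
        exact hno ⟨_, hext α β hβ⟩ rfl
      · intro q hq hn α hα
        by_contra hno
        push Not at hno
        rcases Nat.lt_or_ge q.natDegree n with h | h
        · obtain ⟨k, hk⟩ := ih.2 q hq h α hα
          exact hno k hk
        have hm : (q * C q.leadingCoeff⁻¹).Monic := monic_mul_leadingCoeff_inv hq
        obtain ⟨β, hβ⟩ := key_sign hG hM ψ φ (fun k => (hc k).symm) n ih.2 ih.1 _ hm
          (by rw [natDegree_mul_C (inv_ne_zero (leadingCoeff_ne_zero.2 hq))]; omega) α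
          (by rw [eval₂_mul, hα, zero_mul]) hno
        exact hno ⟨_, hext β α (fun q => (hβ q).symm)⟩ rfl
  · intro k0
    exact ⟨⟨_, hS0 ⟨k0, rfl⟩⟩, rfl, rfl⟩
end

section germ
open Filter
variable {G : Type} [Field G] [LinearOrder G] [IsStrictOrderedRing G] {ι : Type} (U : Ultrafilter ι)

lemma germ_poly (p : (Germ (U : Filter ι) G)[X]) : ∃ P : ι → G[X], ∀ g : ι → G,
    p.eval (g : Germ (U : Filter ι) G) = ((fun i => (P i).eval (g i) : ι → G) : Germ (U : Filter ι) G) := by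
  induction p using Polynomial.induction_on' with
  | add p q hp hq =>
    obtain ⟨P, hP⟩ := hp
    obtain ⟨Q, hQ⟩ := hq
    refine ⟨fun i => P i + Q i, fun g => ?_⟩
    rw [eval_add, hP, hQ, ← Germ.coe_add]
    congr 1
    funext i; simp
  | monomial n a =>
    induction a using Germ.inductionOn with
    | _ a =>
    refine ⟨fun i => monomial n (a i), fun g => ?_⟩
    rw [eval_monomial, ← Germ.coe_pow, ← Germ.coe_mul]
    congr 1
    funext i; simp

lemma germ_pivt (hG : PIVT G) : PIVT (Germ (U : Filter ι) G) := by
  intro p a b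
  induction a using Germ.inductionOn with
  | _ a =>
  induction b using Germ.inductionOn with
  | _ b =>
  obtain ⟨P, hP⟩ := germ_poly U p
  intro hab ha hb
  rw [hP] at ha hb
  have ha' := Germ.coe_lt.1 (ha.trans_eq (Germ.coe_zero).symm)
  have hb' := Germ.coe_lt.1 ((Germ.coe_zero).trans_lt hb)
  have hab' := Germ.coe_lt.1 hab
  have h : ∀ᶠ i in (U : Filter ι), ∃ c, a i < c ∧ c < b i ∧ (P i).eval c = 0 := by
    filter_upwards [ha', hb', hab'] with i h1 h2 h3
    exact hG _ _ _ h3 h1 h2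
  obtain ⟨c, hc⟩ := h.choice
  refine ⟨c, Germ.coe_lt.2 (hc.mono fun i h => h.1), Germ.coe_lt.2 (hc.mono fun i h => h.2.1), ?_⟩
  rw [hP, ← Germ.coe_zero]
  exact Germ.coe_eq.2 (hc.mono fun i h => h.2.2)

/-- constant embedding -/
def germConst : G →+* Germ (U : Filter ι) G where
  toFun g := ((fun _ => g : ι → G) : Germ (U : Filter ι) G)
  map_one' := rfl
  map_zero' := rfl
  map_mul' _ _ := rfl
  map_add' _ _ := rfl

lemma germ_eval₂ {K : Type} [CommRing K] (ψ : K →+* G) (q : K[X]) (g : ι → G) :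
    q.eval₂ ((germConst U).comp ψ) (g : Germ (U : Filter ι) G) =
      ((fun i => q.eval₂ ψ (g i) : ι → G) : Germ (U : Filter ι) G) := by
  induction q using Polynomial.induction_on' with
  | add p q hp hq =>
    rw [eval₂_add, hp, hq, ← Germ.coe_add]
    congr 1
    funext i; simp [eval₂_add]
  | monomial n a =>
    rw [eval₂_monomial, ← Germ.coe_pow]
    simp only [eval₂_monomial]
    rfl

lemma germ_closed {K : Type} [Field K] (ψ : K →+* G) (n : ℕ) (h : ClosedBelow ψ n) :
    ClosedBelow ((germConst U).comp ψ) n := by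
  classical
  intro q hq hn α
  induction α using Germ.inductionOn with
  | _ g =>
  intro h0
  rw [germ_eval₂, ← Germ.coe_zero, Germ.coe_eq] at h0
  have h1 : ∀ᶠ i in (U : Filter ι), ∃ k ∈ (q.roots.toFinset : Set K), ψ k = g i := by
    filter_upwards [h0] with i hi
    obtain ⟨k, hk⟩ := h q hq hn (g i) hi
    refine ⟨k, ?_, hk⟩
    simp only [Pi.zero_apply] at hi
    rw [← hk, eval₂_at_apply, map_eq_zero] at hi
    simp [hq, hi]
  rw [Ultrafilter.eventually_exists_mem_iff (Finset.finite_toSet _)] at h1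
  obtain ⟨k, -, hk⟩ := h1
  exact ⟨k, Germ.coe_eq.2 hk⟩

lemma germ_sign_const (g : G) : SignType.sign (germConst U g) = SignType.sign g := by
  rcases lt_trichotomy g 0 with h | rfl | h
  · rw [sign_neg h, sign_neg]
    exact Germ.coe_lt.2 (Eventually.of_forall fun _ => h)
  · simp
  · rw [sign_pos h, sign_pos]
    exact Germ.coe_lt.2 (Eventually.of_forall fun _ => h)
end germ


section
open Filter
variable {K M G : Type} [Field K] [Field M] [LinearOrder M] [IsStrictOrderedRing M]
  [Field G] [LinearOrder G] [IsStrictOrderedRing G]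

lemma exists_cut (φ : K →+* M) (ψ : K →+* G)
    (hc : ∀ k, SignType.sign (φ k) = SignType.sign (ψ k)) (x : M) (hx : ∀ k, φ k ≠ x) :
    ∃ U : Ultrafilter G, ∀ k, SignType.sign (x - φ k) =
      SignType.sign (((fun g => g : G → G) : Germ (U : Filter G) G) - (germConst U).comp ψ k) := by
  classical
  let A : K → Set G := fun k => {g | SignType.sign (g - ψ k) = SignType.sign (x - φ k)}
  obtain ⟨U, hU⟩ := Ultrafilter.exists_ultrafilter_of_finite_inter_nonempty (Set.range A) (by
    intro T hT
    rw [← Set.image_univ] at hT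
    obtain ⟨t, -, rfl⟩ := Finset.subset_set_image_iff.1 hT
    obtain ⟨g, hg1, hg2⟩ := Order.exists_between_finsets
      (lo := (t.filter (fun k => φ k < x)).image ψ) (hi := (t.filter (fun k => x < φ k)).image ψ) (by
      intro u hu v hv
      obtain ⟨k, hk, rfl⟩ := Finset.mem_image.1 hu
      obtain ⟨l, hl, rfl⟩ := Finset.mem_image.1 hv
      exact (lt_iff_of_compat hc k l).1
        ((Finset.mem_filter.1 hk).2.trans (Finset.mem_filter.1 hl).2))
    refine ⟨g, ?_⟩
    rw [Set.mem_sInter]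
    intro B hB
    obtain ⟨k, hk, rfl⟩ := Finset.mem_image.1 (Finset.mem_coe.1 hB)
    rcases lt_or_gt_of_ne (hx k) with h | h
    · have := hg1 (ψ k) (Finset.mem_image_of_mem _ (Finset.mem_filter.2 ⟨hk, h⟩))
      change SignType.sign _ = SignType.sign _
      rw [sign_pos (sub_pos.2 this), sign_pos (sub_pos.2 h)]
    · have := hg2 (ψ k) (Finset.mem_image_of_mem _ (Finset.mem_filter.2 ⟨hk, h⟩))
      change SignType.sign _ = SignType.sign _
      rw [sign_neg (sub_neg.2 this), sign_neg (sub_neg.2 h)])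
  refine ⟨U, fun k => ?_⟩
  have hk : ∀ᶠ g in (U : Filter G), SignType.sign (g - ψ k) = SignType.sign (x - φ k) :=
    hU ⟨k, rfl⟩
  rcases lt_or_gt_of_ne (hx k) with h | h
  · rw [sign_pos (sub_pos.2 h)] at hk ⊢
    rw [sign_pos]
    refine sub_pos.2 (Germ.coe_lt.2 (hk.mono fun g hg => ?_))
    exact sub_pos.1 (sign_eq_one_iff.1 hg)
  · rw [sign_neg (sub_neg.2 h)] at hk ⊢
    rw [sign_neg]
    refine sub_neg.2 (Germ.coe_lt.2 (hk.mono fun g hg => ?_))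
    exact sub_neg.1 (sign_eq_neg_one_iff.1 hg)

lemma germ_mv_eval₂ {ι : Type} (U : Ultrafilter ι) {d : ℕ} (ρ : ℝ →+* G)
    (f : MvPolynomial (Fin d) ℝ) (y : Fin d → ι → G) :
    f.eval₂ ((germConst U).comp ρ) (fun j => (y j : Germ (U : Filter ι) G)) =
      ((fun i => f.eval₂ ρ (fun j => y j i) : ι → G) : Germ (U : Filter ι) G) := by
  induction f using MvPolynomial.induction_on with
  | C a => simp only [MvPolynomial.eval₂_C]; rfl
  | add p q hp hq =>
    rw [MvPolynomial.eval₂_add, hp, hq, ← Germ.coe_add]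
    congr 1
    funext i; simp [MvPolynomial.eval₂_add]
  | mul_X p j hp =>
    rw [MvPolynomial.eval₂_mul, hp, MvPolynomial.eval₂_X, ← Germ.coe_mul]
    congr 1
    funext i; simp [MvPolynomial.eval₂_mul]

lemma pivt_real : PIVT ℝ := by
  intro p a b hab ha hb
  obtain ⟨c, hc, h⟩ := intermediate_value_Ioo hab.le p.continuousOn ⟨ha, hb⟩
  exact ⟨c, hc.1, hc.2, h⟩

lemma real_hom_sign (ρ : ℝ →+* M) (r : ℝ) : SignType.sign (ρ r) = SignType.sign r := by
  have key : ∀ r : ℝ, 0 < r → 0 < ρ r := by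
    intro r hr
    have h0 : ρ r ≠ 0 := by simpa using hr.ne'
    refine lt_of_le_of_ne ?_ h0.symm
    rw [← Real.mul_self_sqrt hr.le, map_mul]
    exact mul_self_nonneg _
  rcases lt_trichotomy r 0 with h | rfl | h
  · have := key (-r) (by linarith)
    rw [map_neg] at this
    rw [sign_neg h, sign_neg (by linarith)]
  · simp
  · rw [sign_pos h, sign_pos (key r h)]

theorem transfer (hM : PIVT M) (ι0 : ℝ →+* M) {d : ℕ} {I : Type} [Finite I]
    (f : I → MvPolynomial (Fin d) ℝ) (x : Fin d → M) :
    ∃ a : Fin d → ℝ, ∀ i, 0 ≤ (f i).eval₂ ι0 x → 0 ≤ MvPolynomial.eval a (f i) := by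
  classical
  have main : ∀ s : Finset (Fin d), ∃ (G : Type) (_ : Field G) (_ : LinearOrder G)
      (_ : IsStrictOrderedRing G) (_ : PIVT G) (ρ : ℝ →+* G)
      (_ : ∀ y : Fin d → G, ∃ a : Fin d → ℝ, ∀ i, 0 ≤ (f i).eval₂ ρ y → 0 ≤ MvPolynomial.eval a (f i))
      (K : Type) (_ : Field K) (φ : K →+* M) (ψ : K →+* G),
      (∀ k, SignType.sign (φ k) = SignType.sign (ψ k)) ∧
      (∀ n, ClosedBelow φ n ∧ ClosedBelow ψ n) ∧
      (∀ r, ∃ k, φ k = ι0 r ∧ ψ k = ρ r) ∧ ∀ j ∈ s, ∃ k, φ k = x j := by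
    intro s
    induction s using Finset.induction_on with
    | empty =>
      obtain ⟨K, iK, φ, ψ, h1, h2, h3⟩ := back_forth hM pivt_real ι0 (RingHom.id ℝ)
        (fun k => real_hom_sign ι0 k)
      refine ⟨ℝ, inferInstance, inferInstance, inferInstance, pivt_real, RingHom.id ℝ, ?_, K, iK, φ, ψ,
        h1, h2, h3, by simp⟩
      intro y
      exact ⟨y, fun i h => h⟩
    | insert j s hj ih =>
      obtain ⟨G, iG, lG, oG, hG, ρ, hρ, K, iK, φ, ψ, h1, h2, h3, h4⟩ := ih
      by_cases hxj : ∃ k, φ k = x j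
      · refine ⟨G, iG, lG, oG, hG, ρ, hρ, K, iK, φ, ψ, h1, h2, h3, ?_⟩
        intro l hl
        rcases Finset.mem_insert.1 hl with rfl | hl
        · exact hxj
        · exact h4 l hl
      push Not at hxj
      obtain ⟨U, hU⟩ := exists_cut φ ψ h1 (x j) hxj
      have hG' := germ_pivt U hG
      let ψ' := (germConst U).comp ψ
      have hc' : ∀ k, SignType.sign (φ k) = SignType.sign (ψ' k) := by
        intro k
        rw [h1 k]; exact (germ_sign_const U _).symm
      have hsg := fun q : K[X] => sign_poly hM hG' φ ψ' hc' (q.natDegree + 1) (h2 _).1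
        (germ_closed U ψ _ (h2 _).2) hU q.natDegree q rfl (Nat.lt_succ_self _)
      obtain ⟨K', iK', φ', ψ'', h1', h2', h3'⟩ := back_forth hM hG'
        (eval₂RingHom φ (x j)) (eval₂RingHom ψ' ((fun g => g : G → G) : Germ (U : Filter G) G)) hsg
      refine ⟨Germ (U : Filter G) G, inferInstance, inferInstance, inferInstance, hG',
        (germConst U).comp ρ, ?_, K', iK', φ', ψ'', h1', h2', ?_, ?_⟩
      · intro y
        have : ∀ l, ∃ z : G → G, (z : Germ (U : Filter G) G) = y l := fun l =>
          Quotient.exists_rep (y l)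
        choose z hz using this
        obtain rfl : (fun l => (z l : Germ (U : Filter G) G)) = y := funext hz
        have hev : ∀ᶠ g in (U : Filter G), ∀ i,
            0 ≤ (f i).eval₂ ((germConst U).comp ρ) (fun l => (z l : Germ (U : Filter G) G)) →
            0 ≤ (f i).eval₂ ρ (fun l => z l g) := by
          rw [eventually_all]
          intro i
          by_cases hi : 0 ≤ (f i).eval₂ ((germConst U).comp ρ) (fun l => (z l : Germ (U : Filter G) G))
          · have hi' := hi
            rw [germ_mv_eval₂] at hi'
            have := Germ.coe_le.1 ((Germ.coe_zero).trans_le hi')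
            filter_upwards [this] with g hg _
            exact hg
          · exact Eventually.of_forall fun g h => absurd h hi
        obtain ⟨g, hg⟩ := hev.exists
        obtain ⟨a, ha⟩ := hρ (fun l => z l g)
        exact ⟨a, fun i h => ha i (hg i h)⟩
      · intro r
        obtain ⟨k, hk1, hk2⟩ := h3 r
        obtain ⟨k', hk1', hk2'⟩ := h3' (C k)
        refine ⟨k', ?_, ?_⟩
        · rw [hk1']; simp [hk1]
        · rw [hk2']; simp [ψ', hk2]
      · intro l hl
        rcases Finset.mem_insert.1 hl with rfl | hl
        · obtain ⟨k', hk1', -⟩ := h3' X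
          exact ⟨k', by rw [hk1']; simp⟩
        · obtain ⟨k, hk⟩ := h4 l hl
          obtain ⟨k', hk1', -⟩ := h3' (C k)
          exact ⟨k', by rw [hk1']; simp [hk]⟩
  obtain ⟨G, iG, lG, oG, hG, ρ, hρ, K, iK, φ, ψ, h1, h2, h3, h4⟩ := main Finset.univ
  choose k hk using fun j => h4 j (Finset.mem_univ j)
  obtain ⟨a, ha⟩ := hρ (fun j => ψ (k j))
  refine ⟨a, fun i hi => ha i ?_⟩
  have : ∀ p : MvPolynomial (Fin d) ℝ, ∃ u, φ u = p.eval₂ ι0 x ∧ ψ u = p.eval₂ ρ (fun j => ψ (k j)) := by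
    intro p
    induction p using MvPolynomial.induction_on with
    | C a => simpa using h3 a
    | add p q hp hq =>
      obtain ⟨u, hu1, hu2⟩ := hp
      obtain ⟨v, hv1, hv2⟩ := hq
      exact ⟨u + v, by rw [map_add, hu1, hv1, MvPolynomial.eval₂_add],
        by rw [map_add, hu2, hv2, MvPolynomial.eval₂_add]⟩
    | mul_X p j hp =>
      obtain ⟨u, hu1, hu2⟩ := hp
      exact ⟨u * k j, by rw [map_mul, hu1, hk, MvPolynomial.eval₂_mul, MvPolynomial.eval₂_X],
        by rw [map_mul, hu2, MvPolynomial.eval₂_mul, MvPolynomial.eval₂_X]⟩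
  obtain ⟨u, hu1, hu2⟩ := this (f i)
  rw [← hu2]
  rw [← hu1] at hi
  have h5 := h1 u
  by_contra hneg
  push Not at hneg
  rw [sign_neg hneg, sign_eq_neg_one_iff] at h5
  exact absurd h5 (not_lt.2 hi)
end


lemma exists_order (E : Type) [Field E] (P : Set E) (hadd : ∀ x ∈ P, ∀ y ∈ P, x + y ∈ P)
    (hmul : ∀ x ∈ P, ∀ y ∈ P, x * y ∈ P) (hanti : ∀ x ∈ P, -x ∈ P → x = 0)
    (htot : ∀ x, x ∈ P ∨ -x ∈ P) :
    ∃ (_ : LinearOrder E), IsStrictOrderedRing E ∧ ∀ x : E, 0 ≤ x ↔ x ∈ P := by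
  classical
  have h0 : (0 : E) ∈ P := by simpa using htot 0
  have h1 : (1 : E) ∈ P := by
    rcases htot 1 with h | h
    · exact h
    · simpa using hmul _ h _ h
  let L : LinearOrder E :=
    { le := fun a b => b - a ∈ P
      le_refl := fun a => by simpa using h0
      le_trans := fun a b c hab hbc => by
        have := hadd _ hbc _ hab
        rwa [sub_add_sub_cancel] at this
      le_antisymm := fun a b hab hba => by
        have := hanti (b - a) hab (by simpa using hba)
        exact (sub_eq_zero.1 this).symm
      le_total := fun a b => by
        rcases htot (b - a) with h | h
        · exact Or.inl h
        · right; simpa using h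
      toDecidableLE := Classical.decRel _ }
  have hle : ∀ a b : E, a ≤ b ↔ b - a ∈ P := fun a b => Iff.rfl
  have hO : IsOrderedAddMonoid E :=
    { add_le_add_left := fun a b hab c => by rw [hle] at *; simpa using hab }
  have hZ : ZeroLEOneClass E := ⟨by rw [hle]; simpa using h1⟩
  refine ⟨L, IsStrictOrderedRing.of_mul_pos ?_, fun x => by rw [hle, sub_zero]⟩
  intro a b ha hb
  refine lt_of_le_of_ne ?_ (mul_ne_zero ha.ne' hb.ne').symm
  have ha' := ha.le
  have hb' := hb.le
  rw [hle, sub_zero] at *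
  exact hmul _ ha' _ hb'

structure IsPre {A : Type} [CommRing A] (T : Set A) : Prop where
  add : ∀ x ∈ T, ∀ y ∈ T, x + y ∈ T
  mul : ∀ x ∈ T, ∀ y ∈ T, x * y ∈ T
  sq : ∀ x, x * x ∈ T

lemma IsPre.one {A : Type} [CommRing A] {T : Set A} (h : IsPre T) : (1 : A) ∈ T := by
  simpa using h.sq 1
lemma IsPre.zero {A : Type} [CommRing A] {T : Set A} (h : IsPre T) : (0 : A) ∈ T := by
  simpa using h.sq 0

lemma IsPre.adjoin {A : Type} [CommRing A] {T : Set A} (h : IsPre T) (a : A) :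
    IsPre {x | ∃ s ∈ T, ∃ t ∈ T, x = s + a * t} where
  add := by
    rintro _ ⟨s, hs, t, ht, rfl⟩ _ ⟨s', hs', t', ht', rfl⟩
    exact ⟨s + s', h.add _ hs _ hs', t + t', h.add _ ht _ ht', by ring⟩
  mul := by
    rintro _ ⟨s, hs, t, ht, rfl⟩ _ ⟨s', hs', t', ht', rfl⟩
    refine ⟨s * s' + a * a * (t * t'), h.add _ (h.mul _ hs _ hs') _ (h.mul _ (h.sq a) _ (h.mul _ ht _ ht')),
      s * t' + s' * t, h.add _ (h.mul _ hs _ ht') _ (h.mul _ hs' _ ht), by ring⟩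
  sq := fun x => ⟨x * x, h.sq x, 0, h.zero, by ring⟩

theorem exists_ordered_field {A : Type} [CommRing A] (T : Set A) (hT : IsPre T) (hT1 : (-1 : A) ∉ T) :
    ∃ (F : Type) (_ : Field F) (_ : LinearOrder F) (_ : IsStrictOrderedRing F) (φ : A →+* F),
      ∀ t ∈ T, 0 ≤ φ t := by
  obtain ⟨P, hTP, hP⟩ := zorn_subset_nonempty {P : Set A | IsPre P ∧ (-1 : A) ∉ P} (by
    intro c hc hch hne
    refine ⟨⋃₀ c, ⟨⟨?_, ?_, ?_⟩, ?_⟩, fun s hs => Set.subset_sUnion_of_mem hs⟩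
    · rintro x ⟨s, hs, hxs⟩ y ⟨t, ht, hyt⟩
      obtain ⟨u, hu, hsu, htu⟩ := hch.directedOn s hs t ht
      exact ⟨u, hu, (hc hu).1.add _ (hsu hxs) _ (htu hyt)⟩
    · rintro x ⟨s, hs, hxs⟩ y ⟨t, ht, hyt⟩
      obtain ⟨u, hu, hsu, htu⟩ := hch.directedOn s hs t ht
      exact ⟨u, hu, (hc hu).1.mul _ (hsu hxs) _ (htu hyt)⟩
    · intro x
      obtain ⟨s, hs⟩ := hne
      exact ⟨s, hs, (hc hs).1.sq x⟩
    · rintro ⟨s, hs, h⟩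
      exact (hc hs).2 h) T ⟨hT, hT1⟩
  have hPre : IsPre P := hP.prop.1
  have hP1 : (-1 : A) ∉ P := hP.prop.2
  have hmax : ∀ a, a ∉ P → ∃ s ∈ P, ∃ t ∈ P, -1 = s + a * t := by
    intro a ha
    by_contra hno
    have h2 := hP.le_of_ge (y := {x | ∃ s ∈ P, ∃ t ∈ P, x = s + a * t}) ⟨hPre.adjoin a, hno⟩
      (fun x hx => ⟨x, hx, 0, hPre.zero, by ring⟩)
    exact ha (h2 ⟨0, hPre.zero, 1, hPre.one, by ring⟩)
  have htot : ∀ a, a ∈ P ∨ -a ∈ P := by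
    intro a
    by_contra hno
    push Not at hno
    obtain ⟨s, hs, t, ht, h1⟩ := hmax a hno.1
    obtain ⟨s', hs', t', ht', h2⟩ := hmax (-a) hno.2
    apply hP1
    have : (-1 : A) = s + s' + s * s' + a * a * (t * t') := by
      have e1 : a * t = -1 - s := by rw [h1]; ring
      have e2 : a * t' = 1 + s' := by linear_combination h2
      have : a * a * (t * t') = (a * t) * (a * t') := by ring
      rw [this, e1, e2]; ring
    rw [this]
    exact hPre.add _ (hPre.add _ (hPre.add _ hs _ hs') _ (hPre.mul _ hs _ hs')) _
      (hPre.mul _ (hPre.sq a) _ (hPre.mul _ ht _ ht'))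
  let I : Ideal A :=
    { carrier := {x | x ∈ P ∧ -x ∈ P}
      add_mem' := by
        rintro x y ⟨h1, h2⟩ ⟨h3, h4⟩
        exact ⟨hPre.add _ h1 _ h3, by rw [neg_add]; exact hPre.add _ h2 _ h4⟩
      zero_mem' := ⟨hPre.zero, by simpa using hPre.zero⟩
      smul_mem' := by
        rintro c x ⟨h1, h2⟩
        rcases htot c with h | h
        · exact ⟨hPre.mul _ h _ h1, by simpa using hPre.mul _ h _ h2⟩
        · refine ⟨by simpa using hPre.mul _ h _ h2, by simpa using hPre.mul _ h _ h1⟩ }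
  have hI : ∀ x, x ∈ I ↔ x ∈ P ∧ -x ∈ P := fun x => Iff.rfl
  have aux : ∀ a b, -a ∉ P → -b ∉ P → a * b ∉ I := by
    intro a b ha hb hab
    obtain ⟨s, hs, t, ht, h1⟩ := hmax _ ha
    obtain ⟨s', hs', t', ht', h2⟩ := hmax _ hb
    apply hP1
    have e1 : a * t = 1 + s := by linear_combination h1
    have e2 : b * t' = 1 + s' := by linear_combination h2
    have : (-1 : A) = s + s' + s * s' + -(a * b) * (t * t') := by
      have : -(a * b) * (t * t') = -((a * t) * (b * t')) := by ring
      rw [this, e1, e2]; ring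
    rw [this]
    exact hPre.add _ (hPre.add _ (hPre.add _ hs _ hs') _ (hPre.mul _ hs _ hs')) _
      (hPre.mul _ hab.2 _ (hPre.mul _ ht _ ht'))
  have hprime : I.IsPrime := by
    refine ⟨?_, ?_⟩
    · rw [Ideal.ne_top_iff_one]
      exact fun h => hP1 h.2
    · intro a b hab
      by_contra hno
      push Not at hno
      have hsg : ∀ a, a ∉ I → (-a ∉ P) ∨ (-(-a) ∉ P) := by
        intro a ha
        rw [hI] at ha
        rw [neg_neg]
        tauto
      rcases hsg a hno.1 with h1 | h1 <;> rcases hsg b hno.2 with h2 | h2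
      · exact aux _ _ h1 h2 hab
      · exact aux _ _ h1 h2 (by simpa using I.neg_mem hab)
      · exact aux _ _ h1 h2 (by simpa using I.neg_mem hab)
      · exact aux _ _ h1 h2 (by simpa using hab)
  let F := FractionRing (A ⧸ I)
  let φ : A →+* F := (algebraMap (A ⧸ I) F).comp (Ideal.Quotient.mk I)
  have hφ0 : ∀ a, φ a = 0 ↔ a ∈ I := by
    intro a
    simp only [φ, RingHom.comp_apply]
    rw [FaithfulSMul.algebraMap_eq_zero_iff, Ideal.Quotient.eq_zero_iff_mem]
  have hsurj : ∀ x : F, ∃ a b, φ b ≠ 0 ∧ x * φ b = φ a := by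
    intro x
    obtain ⟨a, b, hb, rfl⟩ := IsFractionRing.div_surjective (A := A ⧸ I) x
    obtain ⟨a, rfl⟩ := Ideal.Quotient.mk_surjective a
    obtain ⟨b, rfl⟩ := Ideal.Quotient.mk_surjective b
    have hb' : φ b ≠ 0 := by
      simp only [φ, RingHom.comp_apply]
      rw [Ne, FaithfulSMul.algebraMap_eq_zero_iff]
      exact nonZeroDivisors.ne_zero hb
    refine ⟨a, b, hb', ?_⟩
    exact div_mul_cancel₀ _ hb'
  obtain ⟨L, hL, hLP⟩ := exists_order F {x | ∃ p ∈ P, ∃ c, φ c ≠ 0 ∧ x * (φ c * φ c) = φ p} (by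
      rintro x ⟨p, hp, c, hc, h⟩ y ⟨p', hp', c', hc', h'⟩
      refine ⟨p * (c' * c') + p' * (c * c), hPre.add _ (hPre.mul _ hp _ (hPre.sq _)) _
        (hPre.mul _ hp' _ (hPre.sq _)), c * c', by rw [map_mul]; exact mul_ne_zero hc hc', ?_⟩
      simp only [map_add, map_mul, ← h, ← h']; ring) (by
      rintro x ⟨p, hp, c, hc, h⟩ y ⟨p', hp', c', hc', h'⟩
      refine ⟨p * p', hPre.mul _ hp _ hp', c * c', by rw [map_mul]; exact mul_ne_zero hc hc', ?_⟩
      simp only [map_mul, ← h, ← h']; ring) (by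
      rintro x ⟨p, hp, c, hc, h⟩ ⟨p', hp', c', hc', h'⟩
      have h1 : φ (p * (c' * c') + p' * (c * c)) = 0 := by
        simp only [map_add, map_mul, ← h, ← h']; ring
      rw [hφ0] at h1
      have h2 : p * (c' * c') ∈ I := by
        refine ⟨hPre.mul _ hp _ (hPre.sq _), ?_⟩
        have := hPre.add _ h1.2 _ (hPre.mul _ hp' _ (hPre.sq c))
        convert this using 1; ring
      rw [← hφ0, map_mul, map_mul, ← h] at h2
      simpa [hc, hc'] using h2) (by
      intro x
      obtain ⟨a, b, hb, h⟩ := hsurj x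
      rcases htot (a * b) with hab | hab
      · left
        exact ⟨_, hab, b, hb, by rw [map_mul, ← h]; ring⟩
      · right
        exact ⟨_, hab, b, hb, by rw [map_neg, map_mul, ← h]; ring⟩)
  refine ⟨F, inferInstance, L, hL, φ, fun t ht => (hLP _).2 ⟨t, hTP ht, 1, by simp, by simp⟩⟩


/-- sums of weighted squares -/
inductive WSq (E : Type) [Field E] [LinearOrder E] : E[X] → Prop
  | zero : WSq E 0
  | add (s r : E[X]) (c : E) : 0 ≤ c → WSq E s → WSq E (s + C c * r ^ 2)

lemma WSq.add' {E : Type} [Field E] [LinearOrder E] {s t : E[X]} (hs : WSq E s) (ht : WSq E t) :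
    WSq E (s + t) := by
  induction ht with
  | zero => simpa using hs
  | add t r c hc _ ih => rw [← add_assoc]; exact WSq.add _ _ _ hc ih

lemma WSq.single {E : Type} [Field E] [LinearOrder E] (r : E[X]) (c : E) (hc : 0 ≤ c) :
    WSq E (C c * r ^ 2) := by
  simpa using WSq.add 0 r c hc WSq.zero

lemma WSq.smul {E : Type} [Field E] [LinearOrder E] [IsStrictOrderedRing E] {s : E[X]} (r : E[X]) (c : E) (hc : 0 ≤ c)
    (hs : WSq E s) : WSq E (s * (C c * r ^ 2)) := by
  induction hs with
  | zero => simpa using WSq.zero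
  | add t r' c' hc' _ ih =>
    rw [add_mul]
    refine ih.add' ?_
    have : C c' * r' ^ 2 * (C c * r ^ 2) = C (c' * c) * (r' * r) ^ 2 := by rw [C_mul]; ring
    rw [this]
    exact WSq.single _ _ (mul_nonneg hc' hc)

lemma WSq.mul' {E : Type} [Field E] [LinearOrder E] [IsStrictOrderedRing E] {s t : E[X]} (hs : WSq E s) (ht : WSq E t) :
    WSq E (s * t) := by
  induction ht with
  | zero => simpa using WSq.zero
  | add t r c hc _ ih => rw [mul_add]; exact ih.add' (hs.smul _ _ hc)

lemma WSq.eval_nonneg {E : Type} [Field E] [LinearOrder E] [IsStrictOrderedRing E] {s : E[X]} (hs : WSq E s) (a : E) :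
    0 ≤ s.eval a := by
  induction hs with
  | zero => simp
  | add t r c hc _ ih =>
    simp only [eval_add, eval_mul, eval_C, eval_pow]
    exact add_nonneg ih (mul_nonneg hc (sq_nonneg _))

lemma WSq.reduce {E : Type} [Field E] [LinearOrder E] {s : E[X]} (hs : WSq E s) (q : E[X])
    (hq : 0 < q.natDegree) :
    ∃ s', WSq E s' ∧ q ∣ s - s' ∧ s'.natDegree ≤ 2 * (q.natDegree - 1) := by
  induction hs with
  | zero => exact ⟨0, WSq.zero, by simp, by simp⟩
  | add t r c hc _ ih =>
    obtain ⟨t', h1, h2, h3⟩ := ih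
    refine ⟨t' + C c * (r % q) ^ 2, WSq.add _ _ _ hc h1, ?_, ?_⟩
    · have h4 : q ∣ r - r % q := ⟨r / q, by
        have := EuclideanDomain.div_add_mod r q
        linear_combination -this⟩
      have : t + C c * r ^ 2 - (t' + C c * (r % q) ^ 2) =
        (t - t') + (r - r % q) * (C c * (r + r % q)) := by ring
      rw [this]
      exact dvd_add h2 (h4.mul_right _)
    · refine (natDegree_add_le _ _).trans (max_le h3 ?_)
      refine (natDegree_C_mul_le _ _).trans ?_
      refine natDegree_pow_le.trans ?_
      have := natDegree_mod_lt r hq.ne'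
      gcongr
      omega

lemma artin_schreier {E : Type} [Field E] [LinearOrder E] [IsStrictOrderedRing E] :
    ∀ (n : ℕ) (q : E[X]), q.natDegree = n → ∀ a b s, q.eval a * q.eval b < 0 → WSq E s →
      ¬ q ∣ 1 + s := by
  intro n
  induction n using Nat.strong_induction_on with
  | _ n ih =>
  intro q hn a b s hab hs hdvd
  have hq : 0 < q.natDegree := by
    by_contra h0
    have h0 : q.natDegree = 0 := by omega
    rw [eq_C_of_natDegree_eq_zero h0] at hab
    simp only [eval_C] at hab
    nlinarith [mul_self_nonneg (q.coeff 0)]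
  obtain ⟨s', h1, h2, h3⟩ := hs.reduce q hq
  have h4 : q ∣ 1 + s' := by
    have : 1 + s' = (1 + s) - (s - s') := by ring
    rw [this]; exact dvd_sub hdvd h2
  obtain ⟨g, hg⟩ := h4
  have hne : (1 + s') ≠ 0 := by
    intro h
    have := congrArg (eval a) h
    simp at this
    linarith [h1.eval_nonneg a]
  have hg0 : g ≠ 0 := by rintro rfl; simp at hg; exact hne hg
  have hq0 : q ≠ 0 := by rintro rfl; simp at hq
  have hdeg : (1 + s').natDegree = q.natDegree + g.natDegree := by
    rw [hg, natDegree_mul hq0 hg0]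
  have hle : (1 + s').natDegree ≤ 2 * (q.natDegree - 1) :=
    (natDegree_add_le _ _).trans (max_le (by simp) h3)
  have ea := congrArg (eval a) hg
  have eb := congrArg (eval b) hg
  simp only [eval_add, eval_one, eval_mul] at ea eb
  have hga : 0 < q.eval a * g.eval a := by rw [← ea]; linarith [h1.eval_nonneg a]
  have hgb : 0 < q.eval b * g.eval b := by rw [← eb]; linarith [h1.eval_nonneg b]
  have hgab : g.eval a * g.eval b < 0 := by
    by_contra hc
    push Not at hc
    have := mul_pos hga hgb
    have h5 : q.eval a * g.eval a * (q.eval b * g.eval b) = (q.eval a * q.eval b) * (g.eval a * g.eval b) := by ring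
    rw [h5] at this
    nlinarith
  exact ih g.natDegree (by omega) g rfl a b s' hgab h1 ⟨q, by rw [hg]; ring⟩

lemma exists_order_ext {E : Type} [Field E] [LinearOrder E] [IsStrictOrderedRing E] (q : E[X]) (a b : E)
    (hab : q.eval a * q.eval b < 0) :
    ∃ (F : Type) (_ : Field F) (_ : LinearOrder F) (_ : IsStrictOrderedRing F) (φ : E[X] →+* F),
      φ q = 0 ∧ ∀ c, 0 ≤ c → 0 ≤ φ (C c) := by
  obtain ⟨F, i1, i2, i3, φ, hφ⟩ := exists_ordered_field {t : E[X] | ∃ s, WSq E s ∧ q ∣ t - s}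
    ⟨by
      rintro x ⟨s, hs, h⟩ y ⟨t, ht, h'⟩
      exact ⟨s + t, hs.add' ht, by rw [add_sub_add_comm]; exact dvd_add h h'⟩, by
      rintro x ⟨s, hs, h⟩ y ⟨t, ht, h'⟩
      refine ⟨s * t, hs.mul' ht, ?_⟩
      have : x * y - s * t = (x - s) * y + (y - t) * s := by ring
      rw [this]
      exact dvd_add (h.mul_right _) (h'.mul_right _), by
      intro x
      exact ⟨C 1 * x ^ 2, WSq.single x 1 zero_le_one, by rw [C_1]; ring_nf; simp⟩⟩
    (by
      rintro ⟨s, hs, h⟩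
      refine artin_schreier _ q rfl a b s hab hs ?_
      have : 1 + s = -(-1 - s) := by ring
      rw [this]; exact (dvd_neg).2 h)
  refine ⟨F, i1, i2, i3, φ, ?_, ?_⟩
  · have h1 := hφ q ⟨0, WSq.zero, by simp⟩
    have h2 := hφ (-q) ⟨0, WSq.zero, by simp⟩
    rw [map_neg] at h2
    linarith
  · intro c hc
    exact hφ _ ⟨C c * 1 ^ 2, WSq.single 1 c hc, by simp⟩


structure PC {Ω : Type} [Field Ω] (P : Set Ω) : Prop where
  zero : (0 : Ω) ∈ P
  one : (1 : Ω) ∈ P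
  add : ∀ x ∈ P, ∀ y ∈ P, x + y ∈ P
  mul : ∀ x ∈ P, ∀ y ∈ P, x * y ∈ P
  inv : ∀ x ∈ P, x⁻¹ ∈ P
  anti : ∀ x ∈ P, -x ∈ P → x = 0
  diff : ∀ x ∈ P, ∀ y ∈ P, x - y ∈ P ∨ y - x ∈ P

def PC.fld {Ω : Type} [Field Ω] {P : Set Ω} (h : PC P) : Subfield Ω where
  carrier := {x | x ∈ P ∨ -x ∈ P}
  zero_mem' := Or.inl h.zero
  one_mem' := Or.inl h.one
  neg_mem' := by rintro x (hx | hx) <;> simp [hx]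
  add_mem' := by
    rintro x y (hx | hx) (hy | hy)
    · exact Or.inl (h.add _ hx _ hy)
    · rcases h.diff _ hx _ hy with h | h
      · left; simpa using h
      · right; convert h using 1; ring
    · rcases h.diff _ hx _ hy with h | h
      · right; convert h using 1; ring
      · left; convert h using 1; ring
    · right; rw [neg_add]; exact h.add _ hx _ hy
  mul_mem' := by
    rintro x y (hx | hx) (hy | hy)
    · exact Or.inl (h.mul _ hx _ hy)
    · right; convert h.mul _ hx _ hy using 1; ring
    · right; convert h.mul _ hx _ hy using 1; ring
    · left; convert h.mul _ hx _ hy using 1; ring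
  inv_mem' := by
    rintro x (hx | hx)
    · exact Or.inl (h.inv _ hx)
    · right; rw [← inv_neg]; exact h.inv _ hx

lemma PC.mem_fld {Ω : Type} [Field Ω] {P : Set Ω} (h : PC P) (x : Ω) : x ∈ h.fld ↔ x ∈ P ∨ -x ∈ P :=
  Iff.rfl

lemma exists_irred_sign {E : Type} [Field E] [LinearOrder E] [IsStrictOrderedRing E] (p : E[X])
    (a b : E) : p.eval a * p.eval b < 0 → ∃ q, Irreducible q ∧ q ∣ p ∧ q.eval a * q.eval b < 0 := by
  induction p using WfDvdMonoid.induction_on_irreducible with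
  | zero => simp
  | unit u hu =>
    intro h
    exfalso
    obtain ⟨c, _, rfl⟩ := Polynomial.isUnit_iff.1 hu
    simp only [eval_C] at h
    exact absurd h (not_lt.2 (mul_self_nonneg c))
  | mul p q hp hq ih =>
    intro h
    by_cases h1 : q.eval a * q.eval b < 0
    · exact ⟨q, hq, dvd_mul_right _ _, h1⟩
    · by_cases h2 : p.eval a * p.eval b < 0
      · obtain ⟨r, hr, hrp, hr2⟩ := ih h2
        exact ⟨r, hr, hrp.mul_left _, hr2⟩
      · exfalso
        push Not at h1 h2
        have := mul_nonneg h1 h2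
        simp only [eval_mul] at h
        nlinarith

lemma irred_root_between {E : Type} [Field E] [LinearOrder E] [IsStrictOrderedRing E] (q : E[X])
    (hq : Irreducible q) (a b c : E) (hab : a < b) (h : q.eval a * q.eval b < 0) (hc : q.eval c = 0) :
    a < c ∧ c < b := by
  obtain ⟨u, hu⟩ := dvd_iff_isRoot.2 hc
  have hU : IsUnit u := by
    rcases hq.isUnit_or_isUnit hu with h | h
    · exact absurd h (not_isUnit_X_sub_C c)
    · exact h
  obtain ⟨w, hw, rfl⟩ := Polynomial.isUnit_iff.1 hU
  rw [hu] at h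
  simp only [eval_mul, eval_sub, eval_X, eval_C] at h
  have h2 : (a - c) * w * ((b - c) * w) = ((a - c) * (b - c)) * (w * w) := by ring
  rw [h2] at h
  have h3 : (a - c) * (b - c) < 0 := by
    by_contra hn
    push Not at hn
    exact absurd h (not_lt.2 (mul_nonneg hn (mul_self_nonneg w)))
  rcases mul_neg_iff.1 h3 with h4 | h4
  · exfalso; linarith [h4.1, h4.2]
  · constructor <;> linarith [h4.1, h4.2]

lemma pc_extend {Ω : Type} [Field Ω] [IsAlgClosed Ω] {P : Set Ω} (h : PC P)
    [LinearOrder h.fld] [IsStrictOrderedRing h.fld] (hle : ∀ x : h.fld, 0 ≤ x ↔ (x : Ω) ∈ P)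
    (q : h.fld[X]) (hq : Irreducible q) (a b : h.fld) (hab : q.eval a * q.eval b < 0) :
    ∃ (P' : Set Ω) (θ : Ω), PC P' ∧ P ⊆ P' ∧ aeval θ q = 0 ∧ (θ ∈ P' ∨ -θ ∈ P') := by
  obtain ⟨θ, hθ⟩ := IsAlgClosed.exists_aeval_eq_zero Ω q hq.degree_pos.ne'
  obtain ⟨F, i1, i2, i3, φ, hφq, hφ⟩ := exists_order_ext q a b hab
  have bez : ∀ r, ¬ q ∣ r → ∃ v, aeval θ r * aeval θ v = 1 ∧ φ r * φ v = 1 := by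
    intro r hr
    obtain ⟨u, v, huv⟩ := (hq.coprime_iff_not_dvd).2 hr
    refine ⟨v, ?_, ?_⟩
    · have := congrArg (aeval θ) huv
      simp only [map_add, map_mul, hθ, map_one] at this
      rw [← this]; ring
    · have := congrArg φ huv
      simp only [map_add, map_mul, hφq, map_one] at this
      rw [← this]; ring
  have hd : ∀ r, q ∣ r → aeval θ r = 0 ∧ φ r = 0 := by
    rintro r ⟨s, rfl⟩
    simp [hθ, hφq]
  have h1 : ∀ r, aeval θ r = 0 ↔ φ r = 0 := by
    intro r
    by_cases hr : q ∣ r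
    · simp [hd r hr]
    · obtain ⟨v, e1, e2⟩ := bez r hr
      constructor
      · intro h0; rw [h0] at e1; simp at e1
      · intro h0; rw [h0] at e2; simp at e2
  refine ⟨{z | ∃ r : h.fld[X], z = aeval θ r ∧ 0 ≤ φ r}, θ, ⟨?_, ?_, ?_, ?_, ?_, ?_, ?_⟩, ?_, hθ, ?_⟩
  · exact ⟨0, by simp, by simp⟩
  · exact ⟨1, by simp, by simp⟩
  · rintro _ ⟨r, rfl, hr⟩ _ ⟨s, rfl, hs⟩
    exact ⟨r + s, by simp, by rw [map_add]; exact add_nonneg hr hs⟩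
  · rintro _ ⟨r, rfl, hr⟩ _ ⟨s, rfl, hs⟩
    exact ⟨r * s, by simp, by rw [map_mul]; exact mul_nonneg hr hs⟩
  · rintro _ ⟨r, rfl, hr⟩
    by_cases hqr : q ∣ r
    · exact ⟨0, by simp [hd r hqr], by simp⟩
    · obtain ⟨v, e1, e2⟩ := bez r hqr
      refine ⟨v, inv_eq_of_mul_eq_one_right e1, ?_⟩
      by_contra hv
      push Not at hv
      have := mul_nonneg hr (neg_nonneg.2 hv.le)
      rw [mul_neg, e2] at this
      linarith [zero_lt_one (α := F)]
  · rintro _ ⟨r, rfl, hr⟩ ⟨s, hs, hs0⟩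
    have h2 : aeval θ (r + s) = 0 := by rw [map_add, ← hs]; ring
    rw [h1, map_add] at h2
    rw [h1]
    linarith
  · rintro _ ⟨r, rfl, hr⟩ _ ⟨s, rfl, hs⟩
    rcases le_total (φ r) (φ s) with hh | hh
    · right; exact ⟨s - r, by simp, by rw [map_sub]; linarith⟩
    · left; exact ⟨r - s, by simp, by rw [map_sub]; linarith⟩
  · intro x hx
    refine ⟨C ⟨x, Or.inl hx⟩, ?_, hφ _ ((hle _).2 hx)⟩
    rw [aeval_C]; rfl
  · rcases le_total 0 (φ X) with hh | hh
    · left; exact ⟨X, by simp, hh⟩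
    · right; exact ⟨-X, by simp, by rw [map_neg]; linarith⟩

theorem real_closure {F : Type} [Field F] [LinearOrder F] [IsStrictOrderedRing F] :
    ∃ (M : Type) (_ : Field M) (_ : LinearOrder M) (_ : IsStrictOrderedRing M) (ι : F →+* M),
      PIVT M ∧ ∀ x, 0 ≤ x → 0 ≤ ι x := by
  let Ω := AlgebraicClosure F
  let j : F →+* Ω := algebraMap F Ω
  have hj : Function.Injective j := j.injective
  obtain ⟨P, hTP, hP⟩ := zorn_subset_nonempty {P : Set Ω | PC P} (by
    intro c hc hch hne
    have hne' := hne
    obtain ⟨s0, hs0⟩ := hne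
    refine ⟨⋃₀ c, ⟨⟨s0, hs0, (hc hs0).zero⟩, ⟨s0, hs0, (hc hs0).one⟩, ?_, ?_, ?_, ?_, ?_⟩,
      fun s hs => Set.subset_sUnion_of_mem hs⟩
    · rintro x ⟨s, hs, hxs⟩ y ⟨t, ht, hyt⟩
      obtain ⟨u, hu, hsu, htu⟩ := hch.directedOn s hs t ht
      exact ⟨u, hu, (hc hu).add _ (hsu hxs) _ (htu hyt)⟩
    · rintro x ⟨s, hs, hxs⟩ y ⟨t, ht, hyt⟩
      obtain ⟨u, hu, hsu, htu⟩ := hch.directedOn s hs t ht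
      exact ⟨u, hu, (hc hu).mul _ (hsu hxs) _ (htu hyt)⟩
    · rintro x ⟨s, hs, hxs⟩
      exact ⟨s, hs, (hc hs).inv _ hxs⟩
    · rintro x ⟨s, hs, hxs⟩ ⟨t, ht, hyt⟩
      obtain ⟨u, hu, hsu, htu⟩ := hch.directedOn s hs t ht
      exact (hc hu).anti _ (hsu hxs) (htu hyt)
    · rintro x ⟨s, hs, hxs⟩ y ⟨t, ht, hyt⟩
      obtain ⟨u, hu, hsu, htu⟩ := hch.directedOn s hs t ht
      rcases (hc hu).diff _ (hsu hxs) _ (htu hyt) with h | h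
      · exact Or.inl ⟨u, hu, h⟩
      · exact Or.inr ⟨u, hu, h⟩) (j '' {x | 0 ≤ x}) (by
    refine ⟨⟨0, le_refl _, by simp⟩, ⟨1, zero_le_one, by simp⟩, ?_, ?_, ?_, ?_, ?_⟩
    · rintro _ ⟨x, hx, rfl⟩ _ ⟨y, hy, rfl⟩
      exact ⟨x + y, add_nonneg hx hy, by simp⟩
    · rintro _ ⟨x, hx, rfl⟩ _ ⟨y, hy, rfl⟩
      exact ⟨x * y, mul_nonneg hx hy, by simp⟩
    · rintro _ ⟨x, hx, rfl⟩
      exact ⟨x⁻¹, inv_nonneg.2 hx, by simp⟩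
    · rintro _ ⟨x, hx, rfl⟩ ⟨y, hy, hxy⟩
      rw [← map_neg] at hxy
      have hxy := hj hxy
      have hx : 0 ≤ x := hx
      have hy : 0 ≤ y := hy
      have : x = 0 := by linarith
      simp [this]
    · rintro _ ⟨x, hx, rfl⟩ _ ⟨y, hy, rfl⟩
      rcases le_total x y with h | h
      · right; exact ⟨y - x, sub_nonneg.2 h, by simp⟩
      · left; exact ⟨x - y, sub_nonneg.2 h, by simp⟩)
  have h : PC P := hP.prop
  obtain ⟨L, hL, hle⟩ := exists_order h.fld {x | (x : Ω) ∈ P}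
    (fun x hx y hy => h.add _ hx _ hy) (fun x hx y hy => h.mul _ hx _ hy)
    (fun x hx hx' => Subtype.ext (h.anti _ hx hx')) (fun x => x.2)
  have hjm : ∀ x, j x ∈ h.fld := by
    intro x
    rcases le_total 0 x with hx | hx
    · exact Or.inl (hTP ⟨x, hx, rfl⟩)
    · exact Or.inr (hTP ⟨-x, neg_nonneg.2 hx, by simp⟩)
  refine ⟨h.fld, inferInstance, L, hL, j.codRestrict h.fld hjm, ?_, ?_⟩
  · intro p a b hab ha hb
    obtain ⟨q, hq, ⟨g, hg⟩, hqab⟩ := exists_irred_sign p a b (mul_neg_of_neg_of_pos ha hb)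
    obtain ⟨P', θ, h1, h2, h3, h4⟩ := pc_extend h hle q hq a b hqab
    have h5 := hP.le_of_ge h1 h2
    have hθ : θ ∈ h.fld := h4.imp (fun h => h5 h) (fun h => h5 h)
    have hc : q.eval (⟨θ, hθ⟩ : h.fld) = 0 := by
      have h6 := aeval_algebraMap_apply_eq_algebraMap_eval (A := Ω) (⟨θ, hθ⟩ : h.fld) q
      have h7 : (algebraMap h.fld Ω) ⟨θ, hθ⟩ = θ := rfl
      rw [h7, h3] at h6
      exact (map_eq_zero_iff _ (algebraMap h.fld Ω).injective).1 h6.symm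
    obtain ⟨e1, e2⟩ := irred_root_between q hq a b _ hab hqab hc
    exact ⟨_, e1, e2, by rw [hg, eval_mul, hc, zero_mul]⟩
  · intro x hx
    exact (hle _).2 (hTP ⟨x, hx, rfl⟩)

end helpers

theorem positivstellensatz {d : ℕ} {I : Type} [Finite I] (T : Set (MvPolynomial (Fin d) ℝ)) (hT : IsPre T)
    (h1 : (-1 : MvPolynomial (Fin d) ℝ) ∉ T) (f : I → MvPolynomial (Fin d) ℝ) (hf : ∀ i, f i ∈ T) :
    ∃ a : Fin d → ℝ, ∀ i, 0 ≤ MvPolynomial.eval a (f i) := by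
  obtain ⟨F, i1, i2, i3, φ, hφ⟩ := exists_ordered_field T hT h1
  obtain ⟨M, j1, j2, j3, ι, hM, hι⟩ := real_closure (F := F)
  obtain ⟨a, ha⟩ := transfer hM ((ι.comp φ).comp MvPolynomial.C) f (fun j => ι (φ (MvPolynomial.X j)))
  refine ⟨a, fun i => ha i ?_⟩
  have h2 : (f i).eval₂ ((ι.comp φ).comp MvPolynomial.C) (fun j => ι (φ (MvPolynomial.X j))) = ι (φ (f i)) := by
    have := MvPolynomial.eval₂_comp_left (ι.comp φ) MvPolynomial.C MvPolynomial.X (f i)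
    rw [MvPolynomial.eval₂_eta] at this
    exact this.symm
  rw [h2]
  exact hι _ (hφ _ (hf i))

section final
variable {d : ℕ}

lemma isSOS_iff (p : MvPolynomial (Fin d) ℝ) : IsSOS p ↔ IsSumSq p := by
  constructor
  · rintro ⟨n, q, rfl⟩
    exact IsSumSq.sum (fun i _ => by rw [pow_two]; exact IsSumSq.mul_self _)
  · intro h
    induction h with
    | zero => exact ⟨0, fun _ => 0, by simp⟩
    | sq_add a hs ih =>
      obtain ⟨n, q, rfl⟩ := ih
      exact ⟨n + 1, Fin.cons a q, by rw [Fin.sum_univ_succ]; simp [pow_two]⟩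

lemma inPre_isPre {k : ℕ} (f : Fin k → MvPolynomial (Fin d) ℝ) : IsPre {p | InPreordering f p} := by
  have hadd : ∀ x y, InPreordering f x → InPreordering f y → InPreordering f (x + y) := by
    rintro x y ⟨σ, hσ, rfl⟩ ⟨τ, hτ, rfl⟩
    refine ⟨fun e => σ e + τ e, fun e => ?_, ?_⟩
    · rw [isSOS_iff]; exact ((isSOS_iff _).1 (hσ e)).add ((isSOS_iff _).1 (hτ e))
    · rw [← Finset.sum_add_distrib]; exact Finset.sum_congr rfl fun e _ => by ring
  have hzero : InPreordering f 0 := ⟨fun _ => 0, fun _ => (isSOS_iff _).2 .zero, by simp⟩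
  have hsing : ∀ (e : Fin k → Bool) (s : MvPolynomial (Fin d) ℝ), IsSumSq s → InPreordering f ((∏ i, if e i = true then f i else 1) * s) := by
    intro e s hs
    refine ⟨fun e' => if e' = e then s else 0, fun e' => ?_, ?_⟩
    · rw [isSOS_iff]; dsimp only; split_ifs
      · exact hs
      · exact .zero
    · simp
  have hsum : ∀ {J : Type} (S : Finset J) (g : J → MvPolynomial (Fin d) ℝ),
      (∀ i, InPreordering f (g i)) → InPreordering f (∑ i ∈ S, g i) := by
    intro J S g hg
    classical
    induction S using Finset.induction_on with
    | empty => simpa using hzero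
    | insert a S ha ih => rw [Finset.sum_insert ha]; exact hadd _ _ (hg _) ih
  refine ⟨fun x hx y hy => hadd x y hx hy, ?_, ?_⟩
  · rintro x ⟨σ, hσ, rfl⟩ y ⟨τ, hτ, rfl⟩
    show InPreordering f _
    rw [Finset.sum_mul_sum]
    refine hsum _ _ fun e => hsum _ _ fun e' => ?_
    have key : (∏ i, if e i = true then f i else 1) * σ e * ((∏ i, if e' i = true then f i else 1) * τ e')
      = (∏ i, if (xor (e i) (e' i)) = true then f i else 1) *
        ((∏ i, if (e i && e' i) = true then f i else 1) * (∏ i, if (e i && e' i) = true then f i else 1)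
          * (σ e * τ e')) := by
      have : (∏ i, if e i = true then f i else 1) * (∏ i, if e' i = true then f i else 1)
        = (∏ i, if (xor (e i) (e' i)) = true then f i else 1) *
        ((∏ i, if (e i && e' i) = true then f i else 1) * (∏ i, if (e i && e' i) = true then f i else 1)) := by
        simp only [← Finset.prod_mul_distrib]
        refine Finset.prod_congr rfl fun i _ => ?_
        cases e i <;> cases e' i <;> simp
      linear_combination (σ e * τ e') * this
    rw [key]
    exact hsing (fun i => xor (e i) (e' i)) _
      ((IsSumSq.mul_self _).mul (((isSOS_iff _).1 (hσ e)).mul ((isSOS_iff _).1 (hτ e'))))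
  · intro x
    have := hsing (fun _ => false) _ (IsSumSq.mul_self x)
    simpa using this

lemma inPre_gen {k : ℕ} (f : Fin k → MvPolynomial (Fin d) ℝ) (i : Fin k) : InPreordering f (f i) := by
  refine ⟨fun e => if e = (fun j => decide (j = i)) then 1 else 0, fun e => ?_, ?_⟩
  · rw [isSOS_iff]; dsimp only; split_ifs
    · simpa using IsSumSq.mul_self (1 : MvPolynomial (Fin d) ℝ)
    · exact .zero
  · simp

lemma IsPre.const {T : Set (MvPolynomial (Fin d) ℝ)} (hT : IsPre T) (c : ℝ) (hc : 0 ≤ c) :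
    MvPolynomial.C c ∈ T := by
  have := hT.sq (MvPolynomial.C (Real.sqrt c))
  rwa [← MvPolynomial.C_mul, Real.mul_self_sqrt hc] at this

lemma exists_cert {k : ℕ} (f : Fin k → MvPolynomial (Fin d) ℝ) (h : MvPolynomial (Fin d) ℝ)
    (hpos : ∀ x ∈ SemiAlgSet f, 0 < MvPolynomial.eval x h) :
    ∃ p q, InPreordering f p ∧ InPreordering f q ∧ h * p = 1 + q := by
  have hT := inPre_isPre f
  by_contra hno
  obtain ⟨a, ha⟩ := positivstellensatz (I := Option (Fin k)) _ (hT.adjoin (-h)) (by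
    rintro ⟨s, hs, t, ht, e⟩
    exact hno ⟨t, s, ht, hs, by linear_combination e⟩)
    (fun i => match i with
      | none => -h
      | some i => f i) (by
    rintro (_ | i)
    · exact ⟨0, hT.zero, 1, hT.one, by ring⟩
    · exact ⟨f i, inPre_gen f i, 0, hT.zero, by ring⟩)
  have h1 := hpos a (fun i => ha (some i))
  have h2 := ha none
  simp only [map_neg] at h2
  linarith

/-- elements bounded w.r.t. T -/
def Bdd (T : Set (MvPolynomial (Fin d) ℝ)) (a : MvPolynomial (Fin d) ℝ) : Prop :=
  ∃ n : ℝ, 0 ≤ n ∧ MvPolynomial.C n - a ∈ T ∧ MvPolynomial.C n + a ∈ T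

lemma bdd_all {T : Set (MvPolynomial (Fin d) ℝ)} (hT : IsPre T) (N : ℝ) (hN : 0 ≤ N)
    (hg : MvPolynomial.C N - ∑ i, (MvPolynomial.X i : MvPolynomial (Fin d) ℝ) ^ 2 ∈ T)
    (a : MvPolynomial (Fin d) ℝ) : Bdd T a := by
  have hsq : ∀ (S : Finset (Fin d)), ∑ i ∈ S, (MvPolynomial.X i : MvPolynomial (Fin d) ℝ) ^ 2 ∈ T := by
    intro S
    induction S using Finset.induction_on with
    | empty => simpa using hT.zero
    | insert a S ha ih =>
      rw [Finset.sum_insert ha]; exact hT.add _ (by rw [pow_two]; exact hT.sq _) _ ih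
  have hX : ∀ i, MvPolynomial.C N - (MvPolynomial.X i : MvPolynomial (Fin d) ℝ) ^ 2 ∈ T := by
    intro i
    have := hT.add _ hg _ (hsq (Finset.univ.erase i))
    rw [← Finset.add_sum_erase _ _ (Finset.mem_univ i)] at this
    convert this using 1; ring
  have hadd : ∀ a b, Bdd T a → Bdd T b → Bdd T (a + b) := by
    rintro a b ⟨n, hn, h1, h2⟩ ⟨m, hm, h3, h4⟩
    refine ⟨n + m, by positivity, ?_, ?_⟩
    · convert hT.add _ h1 _ h3 using 1; rw [MvPolynomial.C_add]; ring
    · convert hT.add _ h2 _ h4 using 1; rw [MvPolynomial.C_add]; ring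
  have half : ∀ a, MvPolynomial.C 2 * a ∈ T → a ∈ T := by
    intro a ha
    have := hT.mul _ (hT.const (1/2) (by norm_num)) _ ha
    rw [← mul_assoc, ← MvPolynomial.C_mul] at this
    norm_num at this
    exact this
  have hmul : ∀ a b, Bdd T a → Bdd T b → Bdd T (a * b) := by
    rintro a b ⟨n, hn, h1, h2⟩ ⟨m, hm, h3, h4⟩
    have C2 : (MvPolynomial.C 2 : MvPolynomial (Fin d) ℝ) = 2 := rfl
    refine ⟨n * m, by positivity, half _ ?_, half _ ?_⟩
    · convert hT.add _ (hT.mul _ h1 _ h4) _ (hT.mul _ h2 _ h3) using 1; rw [MvPolynomial.C_mul, C2]; ring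
    · convert hT.add _ (hT.mul _ h1 _ h3) _ (hT.mul _ h2 _ h4) using 1; rw [MvPolynomial.C_mul, C2]; ring
  induction a using MvPolynomial.induction_on with
  | C c =>
    refine ⟨|c|, abs_nonneg _, ?_, ?_⟩
    · rw [← MvPolynomial.C_sub]; exact hT.const _ (by linarith [le_abs_self c])
    · rw [← MvPolynomial.C_add]; exact hT.const _ (by linarith [neg_abs_le c])
  | add p q hp hq => exact hadd _ _ hp hq
  | mul_X p i hp =>
    refine hmul _ _ hp ?_
    have C2 : (MvPolynomial.C 2 : MvPolynomial (Fin d) ℝ) = 2 := rfl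
    refine ⟨(N + 1) / 2, by positivity, half _ ?_, half _ ?_⟩
    · convert hT.add _ (hX i) _ (hT.sq (1 - MvPolynomial.X i)) using 1
      rw [mul_sub, ← MvPolynomial.C_mul, mul_div_cancel₀ _ (by norm_num), MvPolynomial.C_add, C2,
        MvPolynomial.C_1]; ring
    · convert hT.add _ (hX i) _ (hT.sq (1 + MvPolynomial.X i)) using 1
      rw [mul_add, ← MvPolynomial.C_mul, mul_div_cancel₀ _ (by norm_num), MvPolynomial.C_add, C2,
        MvPolynomial.C_1]; ring

lemma bdd_of_cert {T : Set (MvPolynomial (Fin d) ℝ)} (hT : IsPre T) (N : ℝ) (hN : 0 ≤ N)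
    (p q : MvPolynomial (Fin d) ℝ) (hp : p ∈ T) (hq : q ∈ T)
    (hpq : (MvPolynomial.C N - ∑ i, (MvPolynomial.X i : MvPolynomial (Fin d) ℝ) ^ 2) * p = 1 + q)
    (a : MvPolynomial (Fin d) ℝ) : Bdd T a := by
  set S := ∑ i, (MvPolynomial.X i : MvPolynomial (Fin d) ℝ) ^ 2 with hS
  set g := MvPolynomial.C N - S with hg
  have hST : S ∈ T := by
    have : ∀ (S : Finset (Fin d)), ∑ i ∈ S, (MvPolynomial.X i : MvPolynomial (Fin d) ℝ) ^ 2 ∈ T := by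
      intro S
      induction S using Finset.induction_on with
      | empty => simpa using hT.zero
      | insert a S ha ih =>
        rw [Finset.sum_insert ha]; exact hT.add _ (by rw [pow_two]; exact hT.sq _) _ ih
    exact this _
  obtain ⟨m, hm, ⟨s, hs, t, ht, h1⟩, -⟩ := bdd_all (hT.adjoin g) N hN
    ⟨0, hT.zero, 1, hT.one, by ring⟩ q
  have h2 : (MvPolynomial.C m - q) * (1 + q) ∈ T := by
    have e : (MvPolynomial.C m - q) * (1 + q) = s * (1 + q) + p * (g * g) * t := by
      rw [h1]; linear_combination -g * t * hpq
    rw [e]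
    exact hT.add _ (hT.mul _ hs _ (hT.add _ hT.one _ hq)) _ (hT.mul _ (hT.mul _ hp _ (hT.sq g)) _ ht)
  have h3 : MvPolynomial.C (m + m ^ 2 / 4) - q ∈ T := by
    convert hT.add _ h2 _ (hT.sq (MvPolynomial.C (m / 2) - q)) using 1
    have e1 : (MvPolynomial.C m : MvPolynomial (Fin d) ℝ) = 2 * MvPolynomial.C (m / 2) := by
      have C2 : (2 : MvPolynomial (Fin d) ℝ) = MvPolynomial.C 2 := rfl
      rw [C2, ← MvPolynomial.C_mul]; congr 1; ring
    have e2 : (MvPolynomial.C (m + m ^ 2 / 4) : MvPolynomial (Fin d) ℝ) =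
        MvPolynomial.C m + MvPolynomial.C (m / 2) * MvPolynomial.C (m / 2) := by
      rw [← MvPolynomial.C_mul, ← MvPolynomial.C_add]; congr 1; ring
    rw [e2, e1]; ring
  refine bdd_all hT (N + N * (m + m ^ 2 / 4)) (by positivity) ?_ a
  have h4 : (1 + q) * g ∈ T := by
    rw [← hpq]
    convert hT.mul _ (hT.sq g) _ hp using 1; ring
  convert hT.add _ (hT.add _ (hT.mul _ (hT.const N hN) _ h3) _ h4) _ (hT.mul _ hq _ hST) using 1
  rw [MvPolynomial.C_add, MvPolynomial.C_mul, hg]; ring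

lemma mem_of_bdd {T : Set (MvPolynomial (Fin d) ℝ)} (hT : IsPre T) (hb : ∀ a, Bdd T a)
    (h p q : MvPolynomial (Fin d) ℝ) (hp : p ∈ T) (hq : q ∈ T) (hpq : h * p = 1 + q) : h ∈ T := by
  obtain ⟨k0, hk0, hk1, -⟩ := hb p
  obtain ⟨k, hk, hkT⟩ : ∃ k : ℝ, 0 < k ∧ MvPolynomial.C k - p ∈ T := by
    refine ⟨k0 + 1, by positivity, ?_⟩
    convert hT.add _ hk1 _ hT.one using 1
    rw [MvPolynomial.C_add, MvPolynomial.C_1]; ring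
  have step : ∀ r : ℝ, 0 ≤ r → h + MvPolynomial.C r ∈ T → h + MvPolynomial.C (r - 1 / k) ∈ T := by
    intro r hr hh
    have h1 : MvPolynomial.C k * (h + MvPolynomial.C (r - 1 / k)) ∈ T := by
      convert hT.add _ (hT.add _ (hT.mul _ hkT _ hh) _ hq) _ (hT.mul _ (hT.const r hr) _ hp) using 1
      have e : (MvPolynomial.C k : MvPolynomial (Fin d) ℝ) * MvPolynomial.C (r - 1 / k) =
          MvPolynomial.C k * MvPolynomial.C r - 1 := by
        rw [← MvPolynomial.C_1, ← MvPolynomial.C_mul, ← MvPolynomial.C_mul, ← MvPolynomial.C_sub]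
        congr 1; field_simp
      linear_combination e + hpq
    have := hT.mul _ (hT.const (1 / k) (by positivity)) _ h1
    rwa [← mul_assoc, ← MvPolynomial.C_mul, one_div_mul_cancel hk.ne', MvPolynomial.C_1, one_mul] at this
  have hup : ∀ r : ℝ, r ≤ 0 → h + MvPolynomial.C r ∈ T → h ∈ T := by
    intro r hr hh
    convert hT.add _ hh _ (hT.const (-r) (by linarith)) using 1
    rw [MvPolynomial.C_neg]; ring
  have main : ∀ n : ℕ, ∀ r : ℝ, r ≤ n * (1 / k) → h + MvPolynomial.C r ∈ T → h ∈ T := by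
    intro n
    induction n with
    | zero => intro r hr; exact hup r (by simpa using hr)
    | succ n ih =>
      intro r hr hh
      rcases le_total r 0 with h0 | h0
      · exact hup r h0 hh
      · refine ih (r - 1 / k) ?_ (step r h0 hh)
        push_cast at hr
        linarith
  obtain ⟨r, hr, -, hrT⟩ := hb h
  obtain ⟨n, hn⟩ := exists_nat_ge (r * k)
  refine main n r ?_ (by rwa [add_comm])
  rw [mul_one_div, le_div_iff₀ hk]; exact hn

end final

theorem schmuedgen_positivstellensatz {d k : ℕ} (f : Fin k → MvPolynomial (Fin d) ℝ)
    (hK : IsCompact (SemiAlgSet f)) (h : MvPolynomial (Fin d) ℝ)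
    (hpos : ∀ x ∈ SemiAlgSet f, 0 < MvPolynomial.eval x h) :
    InPreordering f h := by
  have hT := inPre_isPre f
  obtain ⟨N, hN⟩ := hK.bddAbove_image (f := fun x : Fin d → ℝ => ∑ i, x i ^ 2)
    (Continuous.continuousOn (by fun_prop))
  have hN' : ∀ x ∈ SemiAlgSet f, ∑ i, x i ^ 2 ≤ N := fun x hx => hN ⟨x, hx, rfl⟩
  obtain ⟨p, q, hp, hq, hpq⟩ := exists_cert f
    (MvPolynomial.C (|N| + 1) - ∑ i, (MvPolynomial.X i : MvPolynomial (Fin d) ℝ) ^ 2) (by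
      intro x hx
      have := hN' x hx
      simp only [map_sub, MvPolynomial.eval_C, map_sum, map_pow, MvPolynomial.eval_X]
      linarith [le_abs_self N])
  obtain ⟨p', q', hp', hq', hpq'⟩ := exists_cert f h hpos
  exact mem_of_bdd hT (bdd_of_cert hT (|N| + 1) (by positivity) p q hp hq hpq) h p' q' hp' hq' hpq'
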